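/- Ramanujan's series for 1/π: the series ∑_{n=0}^∞ ( (4n)! · (1103 + 26390n) ) / ( (n!)^4 · 396^{4n} ) converges, and its sum equals 9801 / (√8 · π); equivalently, 1/π = (√8/9801) · ∑_{n=0}^∞ (4n)!(1103 + 26390n)/((n!)^4 · 396^{4n}). -/

import Mathlib

open Real
open Set Filter Topology MeasureTheory

/-- The coefficients grow at most polynomially. -/
def PolyBounded (c : ℕ → ℝ) : Prop := ∃ k : ℕ, ∀ n : ℕ, |c n| ≤ ((n : ℝ) + 1) ^ k

/-- The sum of the power series with coefficients `c`. -/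
noncomputable def powerSum (c : ℕ → ℝ) (x : ℝ) : ℝ := ∑' n : ℕ, c n * x ^ n

lemma summable_succ_pow_mul_geometric (k : ℕ) {x : ℝ} (h0 : 0 ≤ x) (hx : x < 1) :
    Summable fun n : ℕ => ((n : ℝ) + 1) ^ k * x ^ n := by
  have h1 : Summable fun n : ℕ => (2 : ℝ) ^ k * ((n : ℝ) ^ k * x ^ n + x ^ n) :=
    ((summable_pow_mul_geometric_of_norm_lt_one k (by rwa [norm_of_nonneg h0])).add
      (summable_geometric_of_lt_one h0 hx)).mul_left _
  refine Summable.of_nonneg_of_le (fun n => by positivity) (fun n => ?_) h1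
  have h2 : ((n : ℝ) + 1) ^ k ≤ 2 ^ k * ((n : ℝ) ^ k + 1) := by
    rcases Nat.eq_zero_or_pos n with rfl | hn
    · have : (1 : ℝ) ≤ 2 ^ k := one_le_pow₀ (by norm_num)
      have h3 : (0 : ℝ) ≤ 2 ^ k * 0 ^ k := by positivity
      simp only [CharP.cast_eq_zero, zero_add, one_pow]
      nlinarith
    · have h3 : (1 : ℝ) ≤ n := by exact_mod_cast hn
      calc ((n : ℝ) + 1) ^ k ≤ (2 * n) ^ k := by gcongr; linarith
        _ = 2 ^ k * (n : ℝ) ^ k := mul_pow _ _ _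
        _ ≤ _ := by gcongr; linarith
  calc ((n : ℝ) + 1) ^ k * x ^ n ≤ (2 ^ k * ((n : ℝ) ^ k + 1)) * x ^ n := by gcongr
    _ = _ := by ring

namespace PolyBounded

variable {c : ℕ → ℝ}

lemma summable_norm (hc : PolyBounded c) {x : ℝ} (h0 : 0 ≤ x) (hx : x < 1) :
    Summable fun n : ℕ => |c n| * x ^ n := by
  obtain ⟨k, hk⟩ := hc
  refine Summable.of_nonneg_of_le (fun n => by positivity) (fun n => ?_)
    (summable_succ_pow_mul_geometric k h0 hx)
  gcongr
  exact hk n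

lemma summable (hc : PolyBounded c) {x : ℝ} (hx : |x| < 1) :
    Summable fun n : ℕ => c n * x ^ n := by
  refine Summable.of_norm ?_
  simpa [abs_mul, abs_pow] using hc.summable_norm (abs_nonneg x) hx

lemma nat_mul (hc : PolyBounded c) : PolyBounded fun n => (n : ℝ) * c n := by
  obtain ⟨k, hk⟩ := hc
  refine ⟨k + 1, fun n => ?_⟩
  rw [abs_mul, abs_of_nonneg (Nat.cast_nonneg n), pow_succ, mul_comm]
  gcongr
  · exact hk n
  · linarith

lemma hasSum (hc : PolyBounded c) {x : ℝ} (hx : |x| < 1) :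
    HasSum (fun n : ℕ => c n * x ^ n) (powerSum c x) := (hc.summable hx).hasSum

lemma analyticOnNhd (hc : PolyBounded c) : AnalyticOnNhd ℝ (powerSum c) (Metric.ball 0 1) := by
  have hr : (1 : ENNReal) ≤ (FormalMultilinearSeries.ofScalars ℝ c).radius := by
    refine ENNReal.le_of_forall_nnreal_lt fun r hr => ?_
    refine FormalMultilinearSeries.le_radius_of_summable _ ?_
    simp only [FormalMultilinearSeries.ofScalars_norm, norm_eq_abs]
    exact hc.summable_norm r.2 (by exact_mod_cast hr)
  have h := (FormalMultilinearSeries.ofScalars ℝ c).hasFPowerSeriesOnBall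
    (lt_of_lt_of_le one_pos hr)
  have h2 : (FormalMultilinearSeries.ofScalars ℝ c).sum = powerSum c := by
    ext x
    simp [FormalMultilinearSeries.sum, powerSum, mul_comm]
  rw [h2] at h
  refine h.analyticOnNhd.mono fun x hx => ?_
  refine Metric.eball_subset_eball hr ?_
  rw [← ENNReal.ofReal_one, Metric.eball_ofReal]
  exact hx

/-- Termwise differentiation. -/
lemma hasDerivAt (hc : PolyBounded c) {x : ℝ} (hx : |x| < 1) :
    HasDerivAt (powerSum c) (∑' n : ℕ, c n * (n * x ^ (n - 1))) x := by
  obtain ⟨ρ, hxρ, hρ⟩ := exists_between hx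
  have hρ0 : 0 < ρ := (abs_nonneg x).trans_lt hxρ
  have hs : Summable fun n : ℕ => |(n : ℝ) * c n| * ρ ^ n * ρ⁻¹ :=
    (hc.nat_mul.summable_norm hρ0.le hρ).mul_right _
  refine hasDerivAt_tsum_of_isPreconnected hs (t := Metric.ball 0 ρ) Metric.isOpen_ball
    (convex_ball _ _).isPreconnected (fun n y _ => (hasDerivAt_pow n y).const_mul (c n))
    (fun n y hy => ?_) (y₀ := 0) (by simpa using hρ0)
    (hc.summable (by simp)) (by simpa using hxρ)
  have hy' : |y| ≤ ρ := by simpa using (mem_ball_zero_iff.mp hy).le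
  rcases n with _ | n
  · simp
  · rw [norm_mul, norm_mul, norm_pow, norm_eq_abs, norm_eq_abs, norm_eq_abs, abs_mul, pow_succ]
    have : ρ ^ n * ρ * ρ⁻¹ = ρ ^ n := by field_simp
    rw [mul_assoc, this, Nat.add_sub_cancel, ← mul_assoc, mul_comm |c (n + 1)|]
    gcongr

/-- The Euler operator `x d/dx` multiplies the `n`-th coefficient by `n`. -/
lemma mul_deriv (hc : PolyBounded c) {x : ℝ} (hx : |x| < 1) :
    x * deriv (powerSum c) x = powerSum (fun n => (n : ℝ) * c n) x := by
  rw [(hc.hasDerivAt hx).deriv, ← tsum_mul_left, powerSum]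
  refine tsum_congr fun n => ?_
  rcases n with _ | n
  · simp
  · rw [Nat.add_sub_cancel]; ring

lemma differentiableAt (hc : PolyBounded c) {x : ℝ} (hx : |x| < 1) :
    DifferentiableAt ℝ (powerSum c) x := (hc.hasDerivAt hx).differentiableAt

end PolyBounded

lemma powerSum_zero (c : ℕ → ℝ) : powerSum c 0 = c 0 := by
  rw [powerSum, tsum_eq_single 0]
  · simp
  · intro n hn; simp [hn]

lemma powerSum_shift {c : ℕ → ℝ} (hc : PolyBounded c) {x : ℝ} (hx : |x| < 1) :
    powerSum c x = c 0 + x * powerSum (fun n => c (n + 1)) x := by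
  rw [powerSum, (hc.summable hx).tsum_eq_zero_add, powerSum, ← tsum_mul_left]
  congr 1
  · simp
  · refine tsum_congr fun n => by ring

/-- The derivation `z (1 - z) d/dz`. -/
noncomputable def logisticDeriv (f : ℝ → ℝ) (z : ℝ) : ℝ := z * (1 - z) * deriv f z

lemma logisticDeriv_congr {f g : ℝ → ℝ} {z : ℝ} (h : f =ᶠ[𝓝 z] g) :
    logisticDeriv f =ᶠ[𝓝 z] logisticDeriv g := by
  filter_upwards [h.deriv] with w hw
  rw [logisticDeriv, logisticDeriv, hw]

lemma logisticDeriv_pow_mul {f g : ℝ → ℝ} {n : ℕ} (hg : AnalyticAt ℝ g 0)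
    (hf : f =ᶠ[𝓝 0] fun z => z ^ n * g z) :
    ∃ g₁ : ℝ → ℝ, AnalyticAt ℝ g₁ 0 ∧ g₁ 0 = n * g 0 ∧
      logisticDeriv f =ᶠ[𝓝 0] fun z => z ^ n * g₁ z := by
  refine ⟨fun z => n * (1 - z) * g z + z * (1 - z) * deriv g z, ?_, by simp, ?_⟩
  · have := hg.deriv
    fun_prop
  · refine (logisticDeriv_congr hf).trans ?_
    filter_upwards [hg.eventually_analyticAt] with z hz
    have h := ((hasDerivAt_pow n z).mul hz.differentiableAt.hasDerivAt).deriv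
    have h' : deriv (fun z => z ^ n * g z) z = n * z ^ (n - 1) * g z + z ^ n * deriv g z := h
    rw [logisticDeriv, h']
    rcases n with _ | n
    · simp
    · rw [Nat.add_sub_cancel]; ring

/-- An analytic solution of the symmetric square of `(z (1 - z) d/dz)² = 3/16 z (1 - z)` that
vanishes at the origin vanishes identically. -/
lemma eventuallyEq_zero_of_symmSquare {f : ℝ → ℝ} (hf : AnalyticAt ℝ f 0) (h0 : f 0 = 0)
    (h : ∀ᶠ z in 𝓝 0, logisticDeriv (logisticDeriv (logisticDeriv f)) z =
      3 / 4 * (z * (1 - z)) * logisticDeriv f z +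
        3 / 8 * (z * (1 - z) * (1 - 2 * z)) * f z) :
    f =ᶠ[𝓝 0] 0 := by
  by_contra hne
  obtain ⟨n, g, hg, hg0, hfg⟩ := hf.exists_eventuallyEq_pow_smul_nonzero_iff.mpr hne
  have hfg' : f =ᶠ[𝓝 0] fun z => z ^ n * g z := by
    filter_upwards [hfg] with z hz; simpa using hz
  obtain ⟨g₁, hg₁, e₁, h₁⟩ := logisticDeriv_pow_mul hg hfg'
  obtain ⟨g₂, hg₂, e₂, h₂⟩ := logisticDeriv_pow_mul hg₁ h₁
  obtain ⟨g₃, hg₃, e₃, h₃⟩ := logisticDeriv_pow_mul hg₂ h₂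
  have key : ∀ᶠ z in 𝓝[≠] (0 : ℝ), g₃ z = 3 / 4 * (z * (1 - z)) * g₁ z +
      3 / 8 * (z * (1 - z) * (1 - 2 * z)) * g z := by
    have := h.and (hfg'.and (h₁.and h₃))
    filter_upwards [this.filter_mono nhdsWithin_le_nhds, self_mem_nhdsWithin] with z hz hz0
    obtain ⟨a, b, c, d⟩ := hz
    have hz0' : z ^ n ≠ 0 := pow_ne_zero _ hz0
    rw [b, c, d] at a
    refine mul_left_cancel₀ hz0' ?_
    rw [a]; ring
  have hl : Tendsto g₃ (𝓝[≠] 0) (𝓝 (g₃ 0)) := hg₃.continuousAt.tendsto.mono_left nhdsWithin_le_nhds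
  have hr : Tendsto (fun z : ℝ => 3 / 4 * (z * (1 - z)) * g₁ z +
      3 / 8 * (z * (1 - z) * (1 - 2 * z)) * g z) (𝓝[≠] 0) (𝓝 0) := by
    have hc : ContinuousAt (fun z : ℝ => 3 / 4 * (z * (1 - z)) * g₁ z +
        3 / 8 * (z * (1 - z) * (1 - 2 * z)) * g z) 0 := by
      have := hg.continuousAt
      have := hg₁.continuousAt
      fun_prop
    simpa using hc.tendsto.mono_left nhdsWithin_le_nhds
  have h3 : g₃ 0 = 0 := tendsto_nhds_unique (hl.congr' key) hr
  rw [e₃, e₂, e₁] at h3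
  have hn : n = 0 := by simpa [hg0] using h3
  subst hn
  have := hfg.self_of_nhds
  simp [h0, hg0.symm] at this

/-- Coefficients of `₂F₁(1/4, 3/4; 1; z)`. -/
noncomputable def gaussCoeff (n : ℕ) : ℝ :=
  ((4 * n).factorial : ℝ) / ((2 * n).factorial * (n.factorial : ℝ) ^ 2 * 64 ^ n)

/-- Coefficients of `₃F₂(1/4, 1/2, 3/4; 1, 1; x)`. -/
noncomputable def clausenCoeff (n : ℕ) : ℝ :=
  ((4 * n).factorial : ℝ) / ((n.factorial : ℝ) ^ 4 * 256 ^ n)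

lemma gaussCoeff_zero : gaussCoeff 0 = 1 := by simp [gaussCoeff]

lemma clausenCoeff_zero : clausenCoeff 0 = 1 := by simp [clausenCoeff]

lemma gaussCoeff_succ (n : ℕ) :
    ((n : ℝ) + 1) ^ 2 * gaussCoeff (n + 1) = ((n : ℝ) ^ 2 + n + 3 / 16) * gaussCoeff n := by
  have h4 : 4 * (n + 1) = 4 * n + 1 + 1 + 1 + 1 := by ring
  have h2 : 2 * (n + 1) = 2 * n + 1 + 1 := by ring
  simp only [gaussCoeff, h4, h2, Nat.factorial_succ, pow_succ]
  push_cast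
  have := Nat.factorial_ne_zero n
  field_simp
  ring

lemma clausenCoeff_succ (n : ℕ) :
    ((n : ℝ) + 1) ^ 3 * clausenCoeff (n + 1) =
      ((n : ℝ) ^ 3 + 3 / 2 * n ^ 2 + 11 / 16 * n + 3 / 32) * clausenCoeff n := by
  have h4 : 4 * (n + 1) = 4 * n + 1 + 1 + 1 + 1 := by ring
  simp only [clausenCoeff, h4, Nat.factorial_succ, pow_succ]
  push_cast
  have := Nat.factorial_ne_zero n
  field_simp
  ring

lemma polyBounded_gaussCoeff : PolyBounded gaussCoeff := by
  refine ⟨0, fun n => ?_⟩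
  rw [pow_zero]
  induction n with
  | zero => simp [gaussCoeff_zero]
  | succ n ih =>
    have h0 : ∀ m, 0 ≤ gaussCoeff m := fun m => by unfold gaussCoeff; positivity
    rw [abs_of_nonneg (h0 _)] at ih ⊢
    have h := gaussCoeff_succ n
    have hn : (0 : ℝ) ≤ n := Nat.cast_nonneg n
    have : ((n : ℝ) + 1) ^ 2 * gaussCoeff (n + 1) ≤ ((n : ℝ) + 1) ^ 2 * 1 := by
      rw [h]; refine mul_le_mul ?_ ih (h0 _) (by positivity); nlinarith
    exact le_of_mul_le_mul_left this (by positivity)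

lemma polyBounded_clausenCoeff : PolyBounded clausenCoeff := by
  refine ⟨0, fun n => ?_⟩
  rw [pow_zero]
  induction n with
  | zero => simp [clausenCoeff_zero]
  | succ n ih =>
    have h0 : ∀ m, 0 ≤ clausenCoeff m := fun m => by unfold clausenCoeff; positivity
    rw [abs_of_nonneg (h0 _)] at ih ⊢
    have h := clausenCoeff_succ n
    have hn : (0 : ℝ) ≤ n := Nat.cast_nonneg n
    have : ((n : ℝ) + 1) ^ 3 * clausenCoeff (n + 1) ≤ ((n : ℝ) + 1) ^ 3 * 1 := by
      rw [h]; refine mul_le_mul ?_ ih (h0 _) (by positivity); nlinarith [sq_nonneg (n : ℝ)]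
    exact le_of_mul_le_mul_left this (by positivity)

/-- `₂F₁(1/4, 3/4; 1; z)`. -/
noncomputable def gaussF : ℝ → ℝ := powerSum gaussCoeff

lemma gaussF_zero : gaussF 0 = 1 := by rw [gaussF, powerSum_zero, gaussCoeff_zero]

lemma differentiableAt_gaussF {z : ℝ} (hz : |z| < 1) : DifferentiableAt ℝ gaussF z :=
  polyBounded_gaussCoeff.differentiableAt hz

lemma analyticAt_gaussF {z : ℝ} (hz : |z| < 1) : AnalyticAt ℝ gaussF z :=
  polyBounded_gaussCoeff.analyticOnNhd z (by simpa using hz)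

lemma gauss_euler {z : ℝ} (hz : |z| < 1) :
    powerSum (fun n => (n : ℝ) * (n * gaussCoeff n)) z =
      z * (powerSum (fun n => (n : ℝ) * (n * gaussCoeff n)) z +
        powerSum (fun n => (n : ℝ) * gaussCoeff n) z + 3 / 16 * powerSum gaussCoeff z) := by
  have h := polyBounded_gaussCoeff
  conv_lhs => rw [powerSum_shift h.nat_mul.nat_mul hz]
  have h2 := ((h.nat_mul.nat_mul.hasSum hz).add (h.nat_mul.hasSum hz)).add
    ((h.hasSum hz).mul_left (3 / 16))
  rw [← h2.tsum_eq, powerSum]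
  simp only [CharP.cast_eq_zero, zero_mul, zero_add]
  congr 1
  refine tsum_congr fun n => ?_
  push_cast
  linear_combination z ^ n * gaussCoeff_succ n

lemma clausen_euler {x : ℝ} (hx : |x| < 1) :
    powerSum (fun n => (n : ℝ) * (n * (n * clausenCoeff n))) x =
      x * (powerSum (fun n => (n : ℝ) * (n * (n * clausenCoeff n))) x +
        3 / 2 * powerSum (fun n => (n : ℝ) * (n * clausenCoeff n)) x +
        11 / 16 * powerSum (fun n => (n : ℝ) * clausenCoeff n) x +
        3 / 32 * powerSum clausenCoeff x) := by
  have h := polyBounded_clausenCoeff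
  conv_lhs => rw [powerSum_shift h.nat_mul.nat_mul.nat_mul hx]
  have h2 := (((h.nat_mul.nat_mul.nat_mul.hasSum hx).add
    ((h.nat_mul.nat_mul.hasSum hx).mul_left (3 / 2))).add
    ((h.nat_mul.hasSum hx).mul_left (11 / 16))).add ((h.hasSum hx).mul_left (3 / 32))
  rw [← h2.tsum_eq, powerSum]
  simp only [CharP.cast_eq_zero, zero_mul, zero_add]
  congr 1
  refine tsum_congr fun n => ?_
  push_cast
  linear_combination x ^ n * clausenCoeff_succ n

lemma logisticDeriv_gaussF {z : ℝ} (hz : |z| < 1) :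
    logisticDeriv gaussF z = (1 - z) * powerSum (fun n => (n : ℝ) * gaussCoeff n) z := by
  rw [← polyBounded_gaussCoeff.mul_deriv hz, logisticDeriv, gaussF]; ring

/-- The hypergeometric equation in the form `(z (1 - z) u')' = 3/16 u`. -/
lemma hasDerivAt_logisticDeriv_gaussF {z : ℝ} (hz : |z| < 1) (h0 : z ≠ 0) :
    HasDerivAt (logisticDeriv gaussF) (3 / 16 * gaussF z) z := by
  have hb := polyBounded_gaussCoeff
  have hd := (((hasDerivAt_id z).const_sub 1).mul
    (hb.nat_mul.differentiableAt hz).hasDerivAt)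
  have he : logisticDeriv gaussF =ᶠ[𝓝 z]
      fun z => (1 - z) * powerSum (fun n => (n : ℝ) * gaussCoeff n) z := by
    have : ∀ᶠ w in 𝓝 z, |w| < 1 := continuous_abs.continuousAt.eventually_lt continuousAt_const hz
    filter_upwards [this] with w hw using logisticDeriv_gaussF hw
  refine HasDerivAt.congr_of_eventuallyEq ?_ he
  refine hd.congr_deriv ?_
  refine mul_left_cancel₀ h0 ?_
  have h1 := hb.nat_mul.mul_deriv hz
  have h2 := gauss_euler hz
  simp only [id, gaussF]
  linear_combination (1 - z) * h1 + h2

lemma logisticDeriv_eq {f : ℝ → ℝ} {f' z : ℝ} (h : HasDerivAt f f' z) :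
    logisticDeriv f z = z * (1 - z) * f' := by rw [logisticDeriv, h.deriv]

lemma logisticDeriv_logisticDeriv_gaussF {z : ℝ} (hz : |z| < 1) :
    logisticDeriv (logisticDeriv gaussF) z = 3 / 16 * (z * (1 - z)) * gaussF z := by
  rcases eq_or_ne z 0 with rfl | h0
  · simp [logisticDeriv]
  · rw [logisticDeriv_eq (hasDerivAt_logisticDeriv_gaussF hz h0)]; ring

lemma abs_lt_one_of_abs_lt_eighth {z : ℝ} (hz : |z| < 1 / 8) :
    |z| < 1 ∧ |4 * z * (1 - z)| < 1 := by
  rw [abs_lt] at hz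
  refine ⟨abs_lt.mpr ⟨by linarith, by linarith⟩, abs_lt.mpr ⟨by nlinarith, by nlinarith⟩⟩

lemma logisticDeriv_powerSum_comp {c : ℕ → ℝ} (hc : PolyBounded c) {z : ℝ} (hz : |z| < 1 / 8) :
    HasDerivAt (fun z => powerSum c (4 * z * (1 - z)))
        (deriv (powerSum c) (4 * z * (1 - z)) * (4 * (1 - 2 * z))) z ∧
      z * (1 - z) * (deriv (powerSum c) (4 * z * (1 - z)) * (4 * (1 - 2 * z))) =
        (1 - 2 * z) * powerSum (fun n => (n : ℝ) * c n) (4 * z * (1 - z)) := by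
  obtain ⟨-, hx⟩ := abs_lt_one_of_abs_lt_eighth hz
  constructor
  · have h1 : HasDerivAt (fun z : ℝ => 4 * z * (1 - z)) (4 * (1 - 2 * z)) z := by
      have := ((hasDerivAt_id z).const_mul 4).mul ((hasDerivAt_id z).const_sub 1)
      refine this.congr_deriv ?_
      simp; ring
    exact (hc.differentiableAt hx).hasDerivAt.comp z h1
  · rw [← hc.mul_deriv hx]; ring

lemma eventually_abs_lt {z r : ℝ} (hz : |z| < r) : ∀ᶠ w in 𝓝 z, |w| < r :=
  continuous_abs.continuousAt.eventually_lt continuousAt_const hz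

/-- The square of a solution of `(z (1 - z) d/dz)² u = 3/16 z (1 - z) u` solves the symmetric
square equation. -/
lemma symmSquare_gaussF {z : ℝ} (hz : |z| < 1) :
    logisticDeriv (logisticDeriv (logisticDeriv fun z => gaussF z ^ 2)) z =
      3 / 4 * (z * (1 - z)) * logisticDeriv (fun z => gaussF z ^ 2) z +
        3 / 8 * (z * (1 - z) * (1 - 2 * z)) * gaussF z ^ 2 := by
  have e1 : ∀ w, |w| < 1 → logisticDeriv (fun z => gaussF z ^ 2) w =
      2 * gaussF w * logisticDeriv gaussF w := fun w hw => by
    rw [logisticDeriv_eq ((differentiableAt_gaussF hw).hasDerivAt.fun_pow 2), logisticDeriv]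
    ring
  have hD : ∀ w, |w| < 1 → DifferentiableAt ℝ (logisticDeriv gaussF) w := fun w hw => by
    have := (analyticAt_gaussF hw).deriv.differentiableAt
    unfold logisticDeriv
    fun_prop
  have e2 : ∀ w, |w| < 1 → logisticDeriv (logisticDeriv fun z => gaussF z ^ 2) w =
      2 * logisticDeriv gaussF w ^ 2 + 3 / 8 * (w * (1 - w)) * gaussF w ^ 2 := fun w hw => by
    have : logisticDeriv (fun z => gaussF z ^ 2) =ᶠ[𝓝 w]
        fun w => 2 * gaussF w * logisticDeriv gaussF w := by
      filter_upwards [eventually_abs_lt hw] with v hv using e1 v hv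
    rw [(logisticDeriv_congr this).self_of_nhds, logisticDeriv_eq
      (((differentiableAt_gaussF hw).hasDerivAt.const_mul 2).fun_mul (hD w hw).hasDerivAt)]
    have h := logisticDeriv_logisticDeriv_gaussF hw
    have h' : logisticDeriv gaussF w = w * (1 - w) * deriv gaussF w := rfl
    rw [logisticDeriv] at h
    linear_combination 2 * gaussF w * h - 2 * logisticDeriv gaussF w * h'
  have this : logisticDeriv (logisticDeriv fun z => gaussF z ^ 2) =ᶠ[𝓝 z]
      fun w => 2 * logisticDeriv gaussF w ^ 2 + 3 / 8 * (w * (1 - w)) * gaussF w ^ 2 := by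
    filter_upwards [eventually_abs_lt hz] with v hv using e2 v hv
  rw [(logisticDeriv_congr this).self_of_nhds, logisticDeriv_eq
    ((((hD z hz).hasDerivAt.fun_pow 2).const_mul 2).fun_add
      ((((hasDerivAt_id' z).fun_mul ((hasDerivAt_id' z).const_sub 1)).const_mul (3 / 8)).fun_mul
        ((differentiableAt_gaussF hz).hasDerivAt.fun_pow 2))), e1 z hz]
  have h := logisticDeriv_logisticDeriv_gaussF hz
  have h' : logisticDeriv gaussF z = z * (1 - z) * deriv gaussF z := rfl
  rw [logisticDeriv] at h
  simp only [Nat.cast_ofNat, Nat.add_one_sub_one, pow_one]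
  linear_combination 4 * logisticDeriv gaussF z * h -
    (3 / 4) * z * (1 - z) * gaussF z * h'

lemma symmSquare_clausen {z : ℝ} (hz : |z| < 1 / 8) :
    logisticDeriv (logisticDeriv (logisticDeriv
        fun z => powerSum clausenCoeff (4 * z * (1 - z)))) z =
      3 / 4 * (z * (1 - z)) * logisticDeriv (fun z => powerSum clausenCoeff (4 * z * (1 - z))) z +
        3 / 8 * (z * (1 - z) * (1 - 2 * z)) * powerSum clausenCoeff (4 * z * (1 - z)) := by
  have hb := polyBounded_clausenCoeff
  set g₁ : ℝ → ℝ := fun z => powerSum (fun n => (n : ℝ) * clausenCoeff n) (4 * z * (1 - z))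
    with hg₁
  set g₂ : ℝ → ℝ := fun z => powerSum (fun n => (n : ℝ) * (n * clausenCoeff n)) (4 * z * (1 - z))
    with hg₂
  have lin : ∀ w : ℝ, HasDerivAt (fun w : ℝ => 1 - 2 * w) (-2) w := fun w => by
    simpa using ((hasDerivAt_id w).const_mul 2).const_sub 1
  have e1 : ∀ w, |w| < 1 / 8 → logisticDeriv (fun z => powerSum clausenCoeff (4 * z * (1 - z))) w =
      (1 - 2 * w) * g₁ w := fun w hw => by
    obtain ⟨h, h'⟩ := logisticDeriv_powerSum_comp hb hw
    rw [logisticDeriv_eq h, h']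
  have e2 : ∀ w, |w| < 1 / 8 →
      logisticDeriv (logisticDeriv fun z => powerSum clausenCoeff (4 * z * (1 - z))) w =
      (1 - 2 * w) ^ 2 * g₂ w - 2 * (w * (1 - w)) * g₁ w := fun w hw => by
    have : logisticDeriv (fun z => powerSum clausenCoeff (4 * z * (1 - z))) =ᶠ[𝓝 w]
        fun w => (1 - 2 * w) * g₁ w := by
      filter_upwards [eventually_abs_lt hw] with v hv using e1 v hv
    obtain ⟨h, h'⟩ := logisticDeriv_powerSum_comp hb.nat_mul hw
    rw [(logisticDeriv_congr this).self_of_nhds, logisticDeriv_eq ((lin w).fun_mul h)]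
    simp only [hg₁, hg₂]
    linear_combination (1 - 2 * w) * h'
  have this : logisticDeriv (logisticDeriv fun z => powerSum clausenCoeff (4 * z * (1 - z)))
      =ᶠ[𝓝 z] fun w => (1 - 2 * w) ^ 2 * g₂ w - 2 * (w * (1 - w)) * g₁ w := by
    filter_upwards [eventually_abs_lt hz] with v hv using e2 v hv
  obtain ⟨h1, h1'⟩ := logisticDeriv_powerSum_comp hb.nat_mul hz
  obtain ⟨h2, h2'⟩ := logisticDeriv_powerSum_comp hb.nat_mul.nat_mul hz
  rw [(logisticDeriv_congr this).self_of_nhds, logisticDeriv_eq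
    ((((lin z).fun_pow 2).fun_mul h2).fun_sub ((((hasDerivAt_id' z).fun_mul
      ((hasDerivAt_id' z).const_sub 1)).const_mul 2).fun_mul h1)), e1 z hz]
  have h3 := clausen_euler (abs_lt_one_of_abs_lt_eighth hz).2
  simp only [Nat.cast_ofNat, Nat.add_one_sub_one, pow_one, hg₁]
  linear_combination (1 - 2 * z) ^ 2 * h2' - 2 * (z * (1 - z)) * h1' + (1 - 2 * z) * h3

/-- **Clausen's formula** for `₂F₁(1/4, 3/4; 1; z)`. -/
theorem gaussF_sq {z : ℝ} (hz : |z| < 1 / 8) :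
    gaussF z ^ 2 = powerSum clausenCoeff (4 * z * (1 - z)) := by
  have hA : AnalyticOnNhd ℝ (fun z => gaussF z ^ 2) (Metric.ball 0 (1 / 8)) := fun w hw => by
    have hw' : |w| < 1 / 8 := by simpa using hw
    exact (analyticAt_gaussF (abs_lt_one_of_abs_lt_eighth hw').1).pow 2
  have hB : AnalyticOnNhd ℝ (fun z => powerSum clausenCoeff (4 * z * (1 - z)))
      (Metric.ball 0 (1 / 8)) := fun w hw => by
    have hw' : |w| < 1 / 8 := by simpa using hw
    exact AnalyticAt.fun_comp (g := powerSum clausenCoeff)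
      (polyBounded_clausenCoeff.analyticOnNhd _
        (by simpa using (abs_lt_one_of_abs_lt_eighth hw').2)) (by fun_prop)
  have h0 : (0 : ℝ) ∈ Metric.ball (0 : ℝ) (1 / 8) := by simp
  refine hA.eqOn_of_preconnected_of_eventuallyEq hB (convex_ball _ _).isPreconnected h0 ?_
    (by simpa using hz)
  have hd := eventuallyEq_zero_of_symmSquare ((hA 0 h0).sub (hB 0 h0))
    (by simp [gaussF_zero, powerSum_zero, clausenCoeff_zero]) ?_
  · filter_upwards [hd] with w hw using sub_eq_zero.mp hw
  have add : ∀ f g : ℝ → ℝ, AnalyticAt ℝ f 0 → AnalyticAt ℝ g 0 →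
      logisticDeriv (f - g) =ᶠ[𝓝 0] logisticDeriv f - logisticDeriv g := fun f g hf hg => by
    filter_upwards [hf.eventually_analyticAt, hg.eventually_analyticAt] with w h1 h2
    rw [Pi.sub_apply, logisticDeriv, deriv_sub h1.differentiableAt h2.differentiableAt,
      logisticDeriv, logisticDeriv]
    ring
  have an : ∀ f : ℝ → ℝ, AnalyticAt ℝ f 0 → AnalyticAt ℝ (logisticDeriv f) 0 := fun f hf => by
    have := hf.deriv
    unfold logisticDeriv
    fun_prop
  have a0 := hA 0 h0
  have b0 := hB 0 h0
  have c1 := add _ _ a0 b0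
  have c2 := (logisticDeriv_congr c1).trans (add _ _ (an _ a0) (an _ b0))
  have c3 := (logisticDeriv_congr c2).trans (add _ _ (an _ (an _ a0)) (an _ (an _ b0)))
  filter_upwards [c1, c3, Metric.ball_mem_nhds (0 : ℝ) (by norm_num : (0 : ℝ) < 1 / 8)]
    with w h1 h3 hw
  have hw' : |w| < 1 / 8 := by simpa using hw
  rw [h3, h1]
  simp only [Pi.sub_apply]
  rw [symmSquare_gaussF (abs_lt_one_of_abs_lt_eighth hw').1, symmSquare_clausen hw']
  ring

/-- Taylor coefficients of `(1 - w)^(-1/2)`. -/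
noncomputable def invSqrtCoeff (n : ℕ) : ℝ := (n.centralBinom : ℝ) / 4 ^ n

lemma invSqrtCoeff_nonneg (n : ℕ) : 0 ≤ invSqrtCoeff n := by unfold invSqrtCoeff; positivity

lemma invSqrtCoeff_succ (n : ℕ) :
    ((n : ℝ) + 1) * invSqrtCoeff (n + 1) = (n + 1 / 2) * invSqrtCoeff n := by
  have h : ((n : ℝ) + 1) * (n + 1).centralBinom = 2 * (2 * n + 1) * n.centralBinom := by
    exact_mod_cast Nat.succ_mul_centralBinom_succ n
  rw [invSqrtCoeff, invSqrtCoeff, ← mul_div_assoc, h, pow_succ]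
  field_simp
  ring

lemma invSqrtCoeff_zero : invSqrtCoeff 0 = 1 := by simp [invSqrtCoeff]

lemma polyBounded_invSqrtCoeff : PolyBounded invSqrtCoeff := by
  refine ⟨0, fun n => ?_⟩
  rw [pow_zero, abs_of_nonneg (invSqrtCoeff_nonneg n)]
  induction n with
  | zero => simp [invSqrtCoeff_zero]
  | succ n ih =>
    have h := invSqrtCoeff_succ n
    have hn : (0 : ℝ) ≤ n := Nat.cast_nonneg n
    have : ((n : ℝ) + 1) * invSqrtCoeff (n + 1) ≤ ((n : ℝ) + 1) * 1 := by
      rw [h]; nlinarith [invSqrtCoeff_nonneg n]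
    exact le_of_mul_le_mul_left this (by positivity)

lemma powerSum_invSqrtCoeff {x : ℝ} (h0 : 0 ≤ x) (hx : x < 1) :
    powerSum invSqrtCoeff x = 1 / √(1 - x) := by
  have hb := polyBounded_invSqrtCoeff
  have hsq : powerSum invSqrtCoeff x ^ 2 * (1 - x) = 1 := by
    rcases h0.eq_or_lt with rfl | h0
    · simp [powerSum_zero, invSqrtCoeff_zero]
    have hd : ∀ y, |y| < 1 → HasDerivAt (fun y => powerSum invSqrtCoeff y ^ 2 * (1 - y))
        (2 * powerSum invSqrtCoeff y * deriv (powerSum invSqrtCoeff) y * (1 - y) -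
          powerSum invSqrtCoeff y ^ 2) y := fun y hy => by
      refine (((hb.differentiableAt hy).hasDerivAt.fun_pow 2).fun_mul
        ((hasDerivAt_id' y).const_sub 1)).congr_deriv ?_
      simp; ring
    have abs_lt' : ∀ y : ℝ, 0 ≤ y → y < 1 → |y| < 1 := fun y h h' => by rwa [abs_of_nonneg h]
    obtain ⟨y, ⟨hy0, hyx⟩, hy⟩ := exists_hasDerivAt_eq_slope
      (fun y => powerSum invSqrtCoeff y ^ 2 * (1 - y)) _ h0
      (fun y hy => (hd y (abs_lt' y hy.1 (hy.2.trans_lt hx))).continuousAt.continuousWithinAt)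
      (fun y hy => hd y (abs_lt' y hy.1.le (hy.2.trans hx)))
    have hy1 := abs_lt' y hy0.le (hyx.trans hx)
    have e : powerSum (fun n => (n : ℝ) * invSqrtCoeff n) y =
        y * (powerSum (fun n => (n : ℝ) * invSqrtCoeff n) y + 1 / 2 * powerSum invSqrtCoeff y) := by
      conv_lhs => rw [powerSum_shift hb.nat_mul hy1]
      have h2 := (hb.nat_mul.hasSum hy1).add ((hb.hasSum hy1).mul_left (1 / 2))
      rw [← h2.tsum_eq, powerSum]
      simp only [CharP.cast_eq_zero, zero_mul, zero_add]
      congr 1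
      refine tsum_congr fun n => ?_
      push_cast
      linear_combination y ^ n * invSqrtCoeff_succ n
    rw [← hb.mul_deriv hy1] at e
    have e' : deriv (powerSum invSqrtCoeff) y * (1 - y) = 1 / 2 * powerSum invSqrtCoeff y := by
      refine mul_left_cancel₀ hy0.ne' ?_
      linear_combination e
    have hz : 2 * powerSum invSqrtCoeff y * deriv (powerSum invSqrtCoeff) y * (1 - y) -
          powerSum invSqrtCoeff y ^ 2 = 0 := by
      linear_combination 2 * powerSum invSqrtCoeff y * e'
    rw [hz, eq_comm, div_eq_zero_iff, powerSum_zero, invSqrtCoeff_zero] at hy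
    rcases hy with hy | hy <;> linarith
  have hpos : 0 ≤ powerSum invSqrtCoeff x :=
    tsum_nonneg fun n => mul_nonneg (invSqrtCoeff_nonneg n) (pow_nonneg h0 n)
  have h1x : 0 < 1 - x := by linarith
  rw [eq_div_iff (sqrt_pos.mpr h1x).ne', ← sq_eq_sq₀ (by positivity) zero_le_one, mul_pow,
    sq_sqrt h1x.le, hsq, one_pow]

lemma integrable_inv_sq_add_two_pow (m : ℕ) :
    Integrable fun t : ℝ => 1 / (t ^ 2 + 2) ^ (m + 1) := by
  refine integrable_inv_one_add_sq.mono' ?_ (ae_of_all _ fun t => ?_)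
  · exact (Continuous.div continuous_const (by fun_prop) fun t => by
      positivity).aestronglyMeasurable
  · rw [norm_of_nonneg (by positivity), one_div]
    have h2 : 1 ≤ (t ^ 2 + 2) ^ m := one_le_pow₀ (by nlinarith [sq_nonneg t])
    refine inv_anti₀ (by positivity) ?_
    rw [pow_succ (t ^ 2 + 2)]
    nlinarith [sq_nonneg t]

lemma integral_inv_sq_add_two : ∫ t in Ioi (0 : ℝ), 1 / (t ^ 2 + 2) = π / (2 * √2) := by
  have h := integral_Ioi_of_hasDerivAt_of_tendsto' (a := 0) (m := π / 2 / √2)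
    (f := fun t : ℝ => arctan (t / √2) / √2) (f' := fun t : ℝ => 1 / (t ^ 2 + 2))
    (fun t _ => ?_) (by simpa using (integrable_inv_sq_add_two_pow 0).integrableOn) ?_
  · rw [h]; simp; field_simp
  · refine ((((hasDerivAt_id' t).div_const (√2)).arctan).div_const (√2)).congr_deriv ?_
    have : √2 ^ 2 = 2 := sq_sqrt zero_le_two
    field_simp
    rw [this]; ring
  · refine Tendsto.div_const ?_ _
    exact (tendsto_arctan_atTop.mono_right nhdsWithin_le_nhds).comp
      (tendsto_id.atTop_div_const (by positivity))

lemma integral_inv_sq_add_two_pow_succ (m : ℕ) :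
    4 * ((m : ℝ) + 1) * ∫ t in Ioi (0 : ℝ), 1 / (t ^ 2 + 2) ^ (m + 2) =
      (2 * m + 1) * ∫ t in Ioi (0 : ℝ), 1 / (t ^ 2 + 2) ^ (m + 1) := by
  have i1 := (integrable_inv_sq_add_two_pow m).integrableOn (s := Ioi 0)
  have i2 : IntegrableOn (fun t : ℝ => 1 / (t ^ 2 + 2) ^ (m + 2)) (Ioi 0) :=
    (integrable_inv_sq_add_two_pow (m + 1)).integrableOn
  have h := integral_Ioi_of_hasDerivAt_of_tendsto' (a := 0) (m := 0)
    (f := fun t : ℝ => t / (t ^ 2 + 2) ^ (m + 1))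
    (f' := fun t : ℝ => 4 * ((m : ℝ) + 1) * (1 / (t ^ 2 + 2) ^ (m + 2)) -
      (2 * m + 1) * (1 / (t ^ 2 + 2) ^ (m + 1)))
    (fun t _ => ?_) (((i2.const_mul (4 * ((m : ℝ) + 1))).sub (i1.const_mul (2 * (m : ℝ) + 1))).congr
      (ae_of_all _ fun t => rfl)) ?_
  · rw [integral_sub (i2.const_mul _) (i1.const_mul _), integral_const_mul, integral_const_mul] at h
    simpa [sub_eq_zero] using h
  · refine ((hasDerivAt_id' t).fun_div
      ((((hasDerivAt_id' t).fun_pow 2).add_const 2).fun_pow (m + 1))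
      (by positivity)).congr_deriv ?_
    have : t ^ 2 + 2 ≠ 0 := by positivity
    simp only [Nat.add_sub_cancel, Nat.cast_add, Nat.cast_one, pow_succ]
    field_simp
    push_cast
    ring
  · refine squeeze_zero' (g := fun t : ℝ => 1 / t) ?_ ?_ ?_
    · filter_upwards [eventually_gt_atTop 0] with t ht using by positivity
    · filter_upwards [eventually_gt_atTop 0] with t ht
      have h2 : 1 ≤ (t ^ 2 + 2) ^ m := one_le_pow₀ (by nlinarith [sq_nonneg t])
      rw [div_le_div_iff₀ (by positivity) ht, pow_succ]
      nlinarith [sq_nonneg t]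
    · simpa using tendsto_inv_atTop_zero (𝕜 := ℝ)

lemma invSqrtCoeff_mul_integral (n : ℕ) :
    invSqrtCoeff n * 4 ^ n * ∫ t in Ioi (0 : ℝ), 1 / (t ^ 2 + 2) ^ (2 * n + 1) =
      π / (2 * √2) * gaussCoeff n := by
  induction n with
  | zero => simpa [gaussCoeff_zero, invSqrtCoeff_zero] using integral_inv_sq_add_two
  | succ n ih =>
    have e1 := integral_inv_sq_add_two_pow_succ (2 * n)
    have e2 := integral_inv_sq_add_two_pow_succ (2 * n + 1)
    have e3 := invSqrtCoeff_succ n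
    have e4 := gaussCoeff_succ n
    rw [show 2 * (n + 1) + 1 = 2 * n + 1 + 2 by ring]
    rw [show 2 * n + 1 + 1 = 2 * n + 2 by ring] at e2
    push_cast at e1 e2
    have hn : (4 * ((2 : ℝ) * n + 1)) * (4 * (2 * n + 1 + 1)) * (n + 1) ≠ 0 := by positivity
    generalize (∫ t in Ioi (0 : ℝ), 1 / (t ^ 2 + 2) ^ (2 * n + 1)) = a at *
    generalize (∫ t in Ioi (0 : ℝ), 1 / (t ^ 2 + 2) ^ (2 * n + 2)) = b at *
    generalize (∫ t in Ioi (0 : ℝ), 1 / (t ^ 2 + 2) ^ (2 * n + 1 + 2)) = c at *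
    refine mul_left_cancel₀ hn ?_
    rw [pow_succ]
    generalize (4 : ℝ) ^ n = p at *
    generalize invSqrtCoeff (n + 1) = i1 at *
    generalize gaussCoeff (n + 1) = g1 at *
    generalize invSqrtCoeff n = i0 at *
    generalize gaussCoeff n = g0 at *
    linear_combination 16 * p * (2 * n + 1) * (4 * (2 * n + 2) * c) * e3 +
      16 * p * (2 * n + 1) * (n + 1 / 2) * i0 * e2 + 4 * p * (n + 1 / 2) * (4 * n + 3) * i0 * e1 +
      4 * (n + 1 / 2) * (4 * n + 3) * (4 * n + 1) * ih - 32 * (2 * n + 1) * (π / (2 * √2)) * e4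

/-- The quartic whose periods are the values of `gaussF`. -/
noncomputable def quartic (z t : ℝ) : ℝ := (t ^ 2 + 2) ^ 2 - 4 * z

lemma continuous_quartic (z : ℝ) : Continuous (quartic z) := by unfold quartic; fun_prop

lemma le_quartic {z : ℝ} (h0 : 0 ≤ z) (t : ℝ) : (1 - z) * (t ^ 2 + 2) ^ 2 ≤ quartic z t := by
  have : 4 ≤ (t ^ 2 + 2) ^ 2 := by nlinarith [sq_nonneg t]
  unfold quartic
  nlinarith

lemma quartic_pos {z : ℝ} (h0 : 0 ≤ z) (h1 : z < 1) (t : ℝ) : 0 < quartic z t :=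
  lt_of_lt_of_le (mul_pos (by linarith) (by positivity)) (le_quartic h0 t)

lemma continuous_one_div_sqrt_quartic {z : ℝ} (h0 : 0 ≤ z) (h1 : z < 1) :
    Continuous fun t => 1 / √(quartic z t) :=
  continuous_const.div (continuous_quartic z).sqrt fun t => (sqrt_pos.mpr (quartic_pos h0 h1 t)).ne'

lemma one_div_sqrt_quartic_le {z : ℝ} (h0 : 0 ≤ z) (h1 : z < 1) (t : ℝ) :
    1 / √(quartic z t) ≤ 1 / √(1 - z) * (1 / (t ^ 2 + 2)) := by
  have h : 0 < 1 - z := by linarith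
  rw [one_div_mul_one_div]
  refine one_div_le_one_div_of_le (mul_pos (sqrt_pos.mpr h) (by positivity)) ?_
  refine le_sqrt_of_sq_le ?_
  rw [mul_pow, sq_sqrt h.le]
  exact le_quartic h0 t

/-- The period integral `∫₀^∞ dt / √(quartic z t)`. -/
noncomputable def period (z : ℝ) : ℝ := ∫ t in Ioi (0 : ℝ), 1 / √(quartic z t)

/-- The derivative of `period`, up to a factor `2`. -/
noncomputable def periodCube (z : ℝ) : ℝ := ∫ t in Ioi (0 : ℝ), (1 / √(quartic z t)) ^ 3

lemma integrableOn_one_div_sqrt_quartic {z : ℝ} (h0 : 0 ≤ z) (h1 : z < 1) :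
    IntegrableOn (fun t => 1 / √(quartic z t)) (Ioi 0) := by
  refine Integrable.mono' (g := fun t => 1 / √(1 - z) * (1 / (t ^ 2 + 2)))
    (Integrable.const_mul ?_ _)
    (continuous_one_div_sqrt_quartic h0 h1).aestronglyMeasurable (ae_of_all _ fun t => ?_)
  · simpa [IntegrableOn] using (integrable_inv_sq_add_two_pow 0).integrableOn (s := Ioi 0)
  · rw [norm_of_nonneg (by positivity)]
    exact one_div_sqrt_quartic_le h0 h1 t

theorem period_eq_gaussF {z : ℝ} (h0 : 0 ≤ z) (h1 : z < 1) :
    period z = π / (2 * √2) * gaussF z := by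
  have hz : |z| < 1 := by rwa [abs_of_nonneg h0]
  have hi : ∀ n : ℕ, ∫ t in Ioi (0 : ℝ), invSqrtCoeff n * (4 * z) ^ n *
      (1 / (t ^ 2 + 2) ^ (2 * n + 1)) = π / (2 * √2) * (gaussCoeff n * z ^ n) := fun n => by
    rw [integral_const_mul, mul_pow]
    linear_combination z ^ n * invSqrtCoeff_mul_integral n
  have key := hasSum_integral_of_summable_integral_norm (μ := volume.restrict (Ioi (0 : ℝ)))
    (F := fun (n : ℕ) t => invSqrtCoeff n * (4 * z) ^ n * (1 / (t ^ 2 + 2) ^ (2 * n + 1)))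
    (fun n => ((integrable_inv_sq_add_two_pow (2 * n)).integrableOn).const_mul _) ?_
  · simp only [hi] at key
    rw [gaussF, ((polyBounded_gaussCoeff.hasSum hz).mul_left (π / (2 * √2))).unique key, period]
    refine setIntegral_congr_fun measurableSet_Ioi fun t _ => ?_
    have hs : (0 : ℝ) < t ^ 2 + 2 := by positivity
    have hq := quartic_pos h0 h1 t
    have hw : quartic z t = (t ^ 2 + 2) ^ 2 * (1 - 4 * z / (t ^ 2 + 2) ^ 2) := by
      unfold quartic; field_simp
    have hw1 : 4 * z / (t ^ 2 + 2) ^ 2 < 1 := by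
      rw [hw] at hq
      linarith [pos_of_mul_pos_right hq (by positivity)]
    have hp := powerSum_invSqrtCoeff (x := 4 * z / (t ^ 2 + 2) ^ 2) (by positivity) hw1
    rw [hw, sqrt_mul (by positivity), sqrt_sq hs.le, ← one_div_mul_one_div, ← hp, powerSum,
      ← tsum_mul_left]
    refine tsum_congr fun n => ?_
    rw [div_pow, ← pow_mul, pow_succ]
    field_simp
    ring
  · refine (((polyBounded_gaussCoeff.hasSum hz).mul_left (π / (2 * √2))).summable).congr fun n => ?_
    rw [← hi]
    refine setIntegral_congr_fun measurableSet_Ioi fun t _ => ?_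
    have := invSqrtCoeff_nonneg n
    exact (norm_of_nonneg (by positivity)).symm

theorem periodCube_eq {z : ℝ} (h0 : 0 < z) (h1 : z < 1) :
    2 * periodCube z = π / (2 * √2) * deriv gaussF z ∧
      IntegrableOn (fun t => (1 / √(quartic z t)) ^ 3) (Ioi 0) := by
  obtain ⟨b, hzb, hb⟩ := exists_between h1
  have hb0 : 0 < b := h0.trans hzb
  have hc : ∀ x, 0 ≤ x → x < 1 → Continuous fun t => 2 * (1 / √(quartic x t)) ^ 3 :=
    fun x h h' => ((continuous_one_div_sqrt_quartic h h').pow 3).const_mul 2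
  have key := hasDerivAt_integral_of_dominated_loc_of_deriv_le (x₀ := z) (s := Ioo 0 b)
    (μ := volume.restrict (Ioi (0 : ℝ))) (F := fun x t => 1 / √(quartic x t))
    (F' := fun x t => 2 * (1 / √(quartic x t)) ^ 3)
    (bound := fun t => 2 * (1 / √(1 - b)) ^ 3 * (1 / (t ^ 2 + 2) ^ 3))
    (Ioo_mem_nhds h0 hzb) ?_ (integrableOn_one_div_sqrt_quartic h0.le h1)
    (hc z h0.le h1).aestronglyMeasurable ?_
    (((integrable_inv_sq_add_two_pow 2).integrableOn).const_mul _) ?_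
  · obtain ⟨k1, k2⟩ := key
    constructor
    · have e : (fun x => ∫ t in Ioi (0 : ℝ), 1 / √(quartic x t)) =ᶠ[𝓝 z]
          fun x => π / (2 * √2) * gaussF x := by
        filter_upwards [Ioo_mem_nhds h0 h1] with x hx using period_eq_gaussF hx.1.le hx.2
      have h2 := ((differentiableAt_gaussF (by rwa [abs_of_pos h0])).hasDerivAt.const_mul
        (π / (2 * √2))).congr_of_eventuallyEq e
      rw [h2.unique k2, periodCube, integral_const_mul]
    · have := k1.const_mul (1 / 2)
      refine this.congr (ae_of_all _ fun t => ?_)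
      simp only; ring
  · filter_upwards [Ioo_mem_nhds h0 h1] with x hx
    exact (continuous_one_div_sqrt_quartic hx.1.le hx.2).aestronglyMeasurable
  · refine ae_of_all _ fun t x hx => ?_
    rw [norm_of_nonneg (by positivity)]
    have h := one_div_sqrt_quartic_le hx.1.le (hx.2.trans hb) t
    have h' : 1 / √(1 - x) ≤ 1 / √(1 - b) := by
      have : 0 < √(1 - b) := sqrt_pos.mpr (by linarith)
      gcongr
      exact hx.2.le
    have hb' : 1 / √(quartic x t) ≤ 1 / √(1 - b) * (1 / (t ^ 2 + 2)) :=
      h.trans (by gcongr)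
    calc 2 * (1 / √(quartic x t)) ^ 3 ≤ 2 * (1 / √(1 - b) * (1 / (t ^ 2 + 2))) ^ 3 := by gcongr
      _ = _ := by rw [mul_pow, one_div_pow (t ^ 2 + 2)]; ring
  · refine ae_of_all _ fun t x hx => ?_
    have hq := quartic_pos hx.1.le (hx.2.trans hb) t
    have hd : HasDerivAt (fun x => quartic x t) (-4) x := by
      simpa [quartic] using ((hasDerivAt_id x).const_mul 4).const_sub ((t ^ 2 + 2) ^ 2)
    refine ((hasDerivAt_const x 1).fun_div (hd.sqrt hq.ne') (sqrt_pos.mpr hq).ne').congr_deriv ?_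
    have hs := sqrt_pos.mpr hq
    field_simp
    ring

lemma integrable_one_div_sqrt_one_add_sq_cube :
    Integrable fun t : ℝ => (1 / √(1 + t ^ 2)) ^ 3 := by
  refine integrable_inv_one_add_sq.mono' ?_ (ae_of_all _ fun t => ?_)
  · refine (Continuous.pow (continuous_const.div (by fun_prop) fun t => ?_) 3).aestronglyMeasurable
    exact (sqrt_pos.mpr (by positivity)).ne'
  · have h1 : (1 : ℝ) ≤ √(1 + t ^ 2) := one_le_sqrt.mpr (by nlinarith [sq_nonneg t])
    have h2 : √(1 + t ^ 2) ^ 2 = 1 + t ^ 2 := sq_sqrt (by positivity)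
    rw [norm_of_nonneg (by positivity), one_div, inv_pow]
    refine inv_anti₀ (by positivity) ?_
    calc 1 + t ^ 2 = √(1 + t ^ 2) ^ 2 := h2.symm
      _ ≤ √(1 + t ^ 2) ^ 3 := pow_le_pow_right₀ h1 (by norm_num)

lemma integral_one_div_sqrt_one_add_sq_cube :
    ∫ t in Ioi (0 : ℝ), (1 / √(1 + t ^ 2)) ^ 3 = 1 := by
  have h := integral_Ioi_of_hasDerivAt_of_tendsto' (a := 0) (m := 1)
    (f := fun t : ℝ => t / √(1 + t ^ 2)) (f' := fun t : ℝ => (1 / √(1 + t ^ 2)) ^ 3)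
    (fun t _ => ?_) integrable_one_div_sqrt_one_add_sq_cube.integrableOn ?_
  · rw [h]; simp
  · have hs : 0 < √(1 + t ^ 2) := sqrt_pos.mpr (by positivity)
    have h2 : √(1 + t ^ 2) ^ 2 = 1 + t ^ 2 := sq_sqrt (by positivity)
    refine ((hasDerivAt_id' t).fun_div ((((hasDerivAt_id' t).fun_pow 2).const_add 1).sqrt
      (by positivity)) hs.ne').congr_deriv ?_
    field_simp
    rw [h2]
    simp
    ring
  · have h0 : Tendsto (fun t : ℝ => 1 / √((1 / t) ^ 2 + 1)) atTop (𝓝 (1 / √(0 ^ 2 + 1))) := by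
      have : ContinuousAt (fun s : ℝ => 1 / √(s ^ 2 + 1)) 0 := by
        refine continuousAt_const.div (by fun_prop) (by simp)
      refine this.tendsto.comp ?_
      exact tendsto_inv_atTop_zero.congr fun t => (one_div t).symm
    simp only [ne_eq, OfNat.ofNat_ne_zero, not_false_eq_true, zero_pow, zero_add, sqrt_one,
      div_one] at h0
    refine h0.congr' ?_
    filter_upwards [eventually_gt_atTop 0] with t ht
    have : (1 / t) ^ 2 + 1 = (1 + t ^ 2) / t ^ 2 := by field_simp
    rw [this, sqrt_div (by positivity), sqrt_sq ht.le, one_div_div]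

lemma mul_periodCube_one_sub {z : ℝ} (h0 : 0 < z) :
    z * periodCube (1 - z) = ∫ t in Ioi (0 : ℝ), (1 / √(z * t ^ 4 + 4 * t ^ 2 + 4)) ^ 3 := by
  have hz := sqrt_pos.mpr h0
  have h := integral_comp_mul_left_Ioi (fun t => (1 / √(quartic (1 - z) t)) ^ 3) 0 hz
  rw [mul_zero, smul_eq_mul, eq_inv_mul_iff_mul_eq₀ hz.ne'] at h
  rw [periodCube, ← h, ← integral_const_mul, ← integral_const_mul]
  refine setIntegral_congr_fun measurableSet_Ioi fun t _ => ?_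
  have e : quartic (1 - z) (√z * t) = z * (z * t ^ 4 + 4 * t ^ 2 + 4) := by
    rw [quartic, mul_pow, sq_sqrt h0.le]; ring
  rw [e, sqrt_mul h0.le, ← one_div_mul_one_div, mul_pow]
  have h2 : √z ^ 2 = z := sq_sqrt h0.le
  have hp : 0 < √(z * t ^ 4 + 4 * t ^ 2 + 4) := sqrt_pos.mpr (by positivity)
  field_simp
  linear_combination -h2

lemma tendsto_mul_periodCube_one_sub :
    Tendsto (fun z => z * periodCube (1 - z)) (𝓝[>] 0) (𝓝 (1 / 8)) := by
  have h8 : ∀ t : ℝ, 1 / √(4 * t ^ 2 + 4) = 1 / 2 * (1 / √(1 + t ^ 2)) := fun t => by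
    have : 4 * t ^ 2 + 4 = 2 ^ 2 * (1 + t ^ 2) := by ring
    rw [this, sqrt_mul (by norm_num), sqrt_sq zero_le_two, one_div_mul_one_div]
  have key := tendsto_integral_filter_of_dominated_convergence (μ := volume.restrict (Ioi (0 : ℝ)))
    (l := 𝓝[>] (0 : ℝ)) (F := fun z t => (1 / √(z * t ^ 4 + 4 * t ^ 2 + 4)) ^ 3)
    (f := fun t => (1 / √(4 * t ^ 2 + 4)) ^ 3)
    (fun t => 1 / 8 * (1 / √(1 + t ^ 2)) ^ 3) ?_ ?_
    (integrable_one_div_sqrt_one_add_sq_cube.integrableOn.const_mul _) ?_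
  · have e : ∫ t in Ioi (0 : ℝ), (1 / √(4 * t ^ 2 + 4)) ^ 3 = 1 / 8 := by
      simp only [h8, mul_pow]
      rw [integral_const_mul, integral_one_div_sqrt_one_add_sq_cube]; norm_num
    rw [e] at key
    refine key.congr' ?_
    filter_upwards [self_mem_nhdsWithin] with z hz using (mul_periodCube_one_sub hz).symm
  · filter_upwards [self_mem_nhdsWithin] with z hz
    have hz : 0 < z := hz
    refine (Continuous.pow (continuous_const.div (by fun_prop) fun t => ?_) 3).aestronglyMeasurable
    exact (sqrt_pos.mpr (by positivity)).ne'
  · filter_upwards [self_mem_nhdsWithin] with z hz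
    have hz : 0 < z := hz
    refine ae_of_all _ fun t => ?_
    rw [norm_of_nonneg (by positivity)]
    have h : 1 / √(z * t ^ 4 + 4 * t ^ 2 + 4) ≤ 1 / √(4 * t ^ 2 + 4) := by
      have h1 : 0 < √(4 * t ^ 2 + 4) := sqrt_pos.mpr (by positivity)
      have h2 : 0 ≤ z * t ^ 4 := by positivity
      gcongr
      linarith
    calc _ ≤ (1 / √(4 * t ^ 2 + 4)) ^ 3 := by gcongr
      _ = _ := by rw [h8]; ring
  · refine ae_of_all _ fun t => ?_
    have : ContinuousAt (fun z : ℝ => (1 / √(z * t ^ 4 + 4 * t ^ 2 + 4)) ^ 3) 0 := by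
      refine ContinuousAt.pow (continuousAt_const.div (by fun_prop) ?_) 3
      exact (sqrt_pos.mpr (by positivity)).ne'
    simpa using this.tendsto.mono_left nhdsWithin_le_nhds

lemma tendsto_mul_period_one_sub :
    Tendsto (fun z => z * period (1 - z)) (𝓝[>] 0) (𝓝 0) := by
  have hb : Tendsto (fun z : ℝ => √z * (π / (2 * √2))) (𝓝[>] 0) (𝓝 0) := by
    have : ContinuousAt (fun z : ℝ => √z * (π / (2 * √2))) 0 := by fun_prop
    simpa using this.tendsto.mono_left nhdsWithin_le_nhds
  refine squeeze_zero' ?_ ?_ hb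
  · filter_upwards [self_mem_nhdsWithin] with z hz
    exact mul_nonneg (le_of_lt hz) (integral_nonneg fun t => by positivity)
  · filter_upwards [Ioo_mem_nhdsGT (zero_lt_one' ℝ)] with z hz
    obtain ⟨hz0, hz1⟩ := hz
    have h : period (1 - z) ≤ 1 / √z * (π / (2 * √2)) := by
      rw [period, ← integral_inv_sq_add_two, ← integral_const_mul]
      refine integral_mono (integrableOn_one_div_sqrt_quartic (by linarith) (by linarith))
        ?_ fun t => ?_
      · refine Integrable.const_mul ?_ _
        simpa [IntegrableOn] using (integrable_inv_sq_add_two_pow 0).integrableOn (s := Ioi 0)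
      · simpa using one_div_sqrt_quartic_le (z := 1 - z) (by linarith) (by linarith) t
    calc z * period (1 - z) ≤ z * (1 / √z * (π / (2 * √2))) := by gcongr
      _ = z / √z * (π / (2 * √2)) := by ring
      _ = _ := by rw [div_sqrt]

/-- Legendre's relation for `gaussF`. -/
theorem gaussF_legendre {z : ℝ} (h0 : 0 < z) (h1 : z < 1) :
    gaussF z * logisticDeriv gaussF (1 - z) + logisticDeriv gaussF z * gaussF (1 - z) =
      1 / (√2 * π) := by
  set N : ℝ → ℝ := fun z =>
    gaussF z * logisticDeriv gaussF (1 - z) + logisticDeriv gaussF z * gaussF (1 - z) with hN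
  have hd : ∀ w ∈ Ioo (0 : ℝ) 1, HasDerivAt N 0 w := fun w ⟨hw0, hw1⟩ => by
    have a1 : |w| < 1 := by rwa [abs_of_pos hw0]
    have a2 : |1 - w| < 1 := by rw [abs_of_pos] <;> linarith
    have s : HasDerivAt (fun w : ℝ => 1 - w) (-1) w := (hasDerivAt_id' w).const_sub 1
    have d1 := (differentiableAt_gaussF a1).hasDerivAt
    have d2 := (differentiableAt_gaussF a2).hasDerivAt.comp w s
    have d3 := hasDerivAt_logisticDeriv_gaussF a1 hw0.ne'
    have d4 := (hasDerivAt_logisticDeriv_gaussF a2 (by linarith)).comp w s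
    refine ((d1.fun_mul d4).fun_add (d3.fun_mul d2)).congr_deriv ?_
    simp only [Function.comp, logisticDeriv]
    ring
  have hc : ∀ w ∈ Ioo (0 : ℝ) 1, N w = N z := fun w hw =>
    isOpen_Ioo.is_const_of_deriv_eq_zero isPreconnected_Ioo
      (fun v hv => (hd v hv).differentiableAt.differentiableWithinAt)
      (fun v hv => (hd v hv).deriv) hw ⟨h0, h1⟩
  have l1 : Tendsto N (𝓝[>] 0) (𝓝 (N z)) := by
    refine tendsto_const_nhds.congr' ?_
    filter_upwards [Ioo_mem_nhdsGT (zero_lt_one' ℝ)] with w hw using (hc w hw).symm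
  have an := analyticAt_gaussF (z := 0) (by simp)
  have c0 : Tendsto gaussF (𝓝[>] 0) (𝓝 1) := by
    simpa [gaussF_zero] using an.continuousAt.tendsto.mono_left nhdsWithin_le_nhds
  have c1 : Tendsto (deriv gaussF) (𝓝[>] 0) (𝓝 (deriv gaussF 0)) :=
    an.deriv.continuousAt.tendsto.mono_left nhdsWithin_le_nhds
  have c2 : Tendsto (fun z : ℝ => 1 - z) (𝓝[>] 0) (𝓝 1) := by
    have : ContinuousAt (fun z : ℝ => 1 - z) 0 := by fun_prop
    simpa using this.tendsto.mono_left nhdsWithin_le_nhds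
  have l2 := ((c0.mul c2).mul (tendsto_mul_periodCube_one_sub.const_mul (2 * (2 * √2 / π)))).add
    ((c2.mul c1).mul (tendsto_mul_period_one_sub.const_mul (2 * √2 / π)))
  have l3 : Tendsto N (𝓝[>] 0) (𝓝 (1 / (√2 * π))) := by
    have e : 1 * 1 * (2 * (2 * √2 / π) * (1 / 8)) + 1 * deriv gaussF 0 * (2 * √2 / π * 0) =
        1 / (√2 * π) := by
      have : √2 ^ 2 = 2 := sq_sqrt zero_le_two
      field_simp
      linear_combination 4 * this
    rw [e] at l2
    refine l2.congr' ?_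
    filter_upwards [Ioo_mem_nhdsGT (zero_lt_one' ℝ)] with w hw
    obtain ⟨hw0, hw1⟩ := hw
    have p1 := (periodCube_eq (z := 1 - w) (by linarith) (by linarith)).1
    have p2 := period_eq_gaussF (z := 1 - w) (by linarith) (by linarith)
    simp only [hN, logisticDeriv]
    have e1 : deriv gaussF (1 - w) = 2 * (2 * √2 / π) * periodCube (1 - w) := by
      have := pi_pos
      field_simp at p1 ⊢
      linear_combination -p1
    have e2 : gaussF (1 - w) = 2 * √2 / π * period (1 - w) := by
      have := pi_pos
      field_simp at p2 ⊢
      linear_combination -p2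
    rw [e1, e2]
    ring
  exact tendsto_nhds_unique l1 l3

/-- The embedding of `ℤ[√29]` in `ℝ` with `√29 > 0`. -/
noncomputable def sqrtCast : ℤ√29 →+* ℝ :=
  Zsqrtd.lift ⟨√29, by rw [mul_self_sqrt (by norm_num)]; norm_num⟩

lemma sqrtCast_apply (c : ℤ√29) : sqrtCast c = c.re + c.im * √29 := by simp [sqrtCast]

/-- A sufficient criterion, decidable in `ℤ`, for `a + b √29` to be positive. -/
def PosCoeff (c : ℤ√29) : Prop :=
  (0 < c.re ∧ 0 < c.im) ∨ (0 < c.re ∧ 29 * c.im ^ 2 < c.re ^ 2) ∨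
    (0 < c.im ∧ c.re ^ 2 < 29 * c.im ^ 2)

instance : DecidablePred PosCoeff := fun c => by unfold PosCoeff; infer_instance

lemma PosCoeff.sqrtCast_pos {c : ℤ√29} (hc : PosCoeff c) : 0 < sqrtCast c := by
  rw [sqrtCast_apply]
  have hr : 0 < √(29 : ℝ) := by positivity
  have hr2 : √(29 : ℝ) ^ 2 = 29 := sq_sqrt (by norm_num)
  rcases hc with ⟨h1, h2⟩ | ⟨h1, h2⟩ | ⟨h1, h2⟩
  · have h1' : (0 : ℝ) < c.re := by exact_mod_cast h1
    have h2' : (0 : ℝ) < c.im := by exact_mod_cast h2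
    positivity
  · have h1' : (0 : ℝ) < c.re := by exact_mod_cast h1
    have h2' : 29 * (c.im : ℝ) ^ 2 < (c.re : ℝ) ^ 2 := by exact_mod_cast h2
    have := abs_lt_of_sq_lt_sq (a := c.im * √29) (b := (c.re : ℝ))
      (by rw [mul_pow, hr2]; linarith) h1'.le
    linarith [(abs_lt.mp this).1]
  · have h1' : (0 : ℝ) < c.im := by exact_mod_cast h1
    have h2' : (c.re : ℝ) ^ 2 < 29 * (c.im : ℝ) ^ 2 := by exact_mod_cast h2
    have := abs_lt_of_sq_lt_sq (a := (c.re : ℝ)) (b := c.im * √29)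
      (by rw [mul_pow, hr2]; linarith) (by positivity)
    linarith [(abs_lt.mp this).1]

/-- Polynomials over `ℤ[√29]`, as lists of coefficients in order of increasing degree. -/
abbrev SqrtPoly := List (ℤ√29)

namespace SqrtPoly

/-- Evaluation at a real number. -/
noncomputable def eval : SqrtPoly → ℝ → ℝ
  | [], _ => 0
  | c :: l, x => sqrtCast c + x * eval l x

/-- Sum of polynomials. -/
def add : SqrtPoly → SqrtPoly → SqrtPoly
  | [], m => m
  | l, [] => l
  | c :: l, e :: m => (c + e) :: add l m

/-- Multiplication by a constant. -/
def smul (c : ℤ√29) (l : SqrtPoly) : SqrtPoly := l.map (c * ·)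

/-- Product of polynomials. -/
def mul : SqrtPoly → SqrtPoly → SqrtPoly
  | [], _ => []
  | c :: l, m => add (smul c m) (0 :: mul l m)

/-- Formal derivative. -/
def deriv : SqrtPoly → SqrtPoly
  | [] => []
  | [_] => []
  | _ :: c :: l => add (c :: l) (0 :: deriv (c :: l))

/-- Difference of polynomials. -/
def sub (l m : SqrtPoly) : SqrtPoly := add l (smul (-1) m)

@[simp] lemma eval_nil (x : ℝ) : eval [] x = 0 := rfl

@[simp] lemma eval_cons (c : ℤ√29) (l : SqrtPoly) (x : ℝ) :
    eval (c :: l) x = sqrtCast c + x * eval l x := rfl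

@[simp] lemma eval_add (l m : SqrtPoly) (x : ℝ) : eval (add l m) x = eval l x + eval m x := by
  induction l, m using add.induct with
  | case1 m => simp [add]
  | case2 l h => cases l <;> simp_all [add]
  | case3 c l e m ih => simp only [add, eval_cons, map_add, ih]; ring

@[simp] lemma eval_smul (c : ℤ√29) (l : SqrtPoly) (x : ℝ) :
    eval (smul c l) x = sqrtCast c * eval l x := by
  induction l with
  | nil => simp [smul]
  | cons e l ih =>
    rw [smul] at ih
    rw [smul, List.map_cons, eval_cons, eval_cons, ih, map_mul]; ring

@[simp] lemma eval_mul (l m : SqrtPoly) (x : ℝ) : eval (mul l m) x = eval l x * eval m x := by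
  induction l with
  | nil => simp [mul]
  | cons c l ih => simp [mul, ih]; ring

@[simp] lemma eval_sub (l m : SqrtPoly) (x : ℝ) : eval (sub l m) x = eval l x - eval m x := by
  rw [sub, eval_add, eval_smul, map_neg, map_one]; ring

lemma hasDerivAt_eval (l : SqrtPoly) (x : ℝ) : HasDerivAt (eval l) (eval (deriv l) x) x := by
  induction l using deriv.induct with
  | case1 => exact hasDerivAt_const x 0
  | case2 c =>
    have : eval [c] = fun _ => sqrtCast c := by ext; simp
    rw [this]; exact hasDerivAt_const x _
  | case3 e c l ih =>
    refine (((hasDerivAt_id' x).fun_mul ih).const_add (sqrtCast e)).congr_deriv ?_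
    simp [deriv]

lemma eval_eq_zero {l : SqrtPoly} (h : ∀ c ∈ l, c = 0) (x : ℝ) : eval l x = 0 := by
  induction l with
  | nil => rfl
  | cons c l ih =>
    rw [eval_cons, ih fun e he => h e (List.mem_cons_of_mem _ he), h c List.mem_cons_self]
    simp

lemma eval_nonneg {l : SqrtPoly} (h : ∀ c ∈ l, PosCoeff c) {x : ℝ} (hx : 0 ≤ x) :
    0 ≤ eval l x := by
  induction l with
  | nil => exact le_rfl
  | cons c l ih =>
    exact add_nonneg (h c List.mem_cons_self).sqrtCast_pos.le
      (mul_nonneg hx (ih fun e he => h e (List.mem_cons_of_mem _ he)))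

lemma eval_pos {l : SqrtPoly} (h : ∀ c ∈ l, PosCoeff c) (hl : l ≠ []) {x : ℝ} (hx : 0 ≤ x) :
    0 < eval l x := by
  cases l with
  | nil => exact absurd rfl hl
  | cons c l =>
    exact add_pos_of_pos_of_nonneg (h c List.mem_cons_self).sqrtCast_pos
      (mul_nonneg hx (eval_nonneg (fun e he => h e (List.mem_cons_of_mem _ he)) hx))

lemma eval_append (l m : SqrtPoly) (x : ℝ) :
    eval (l ++ m) x = eval l x + x ^ l.length * eval m x := by
  induction l with
  | nil => simp
  | cons c l ih => simp only [List.cons_append, eval_cons, ih, List.length_cons]; ring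

lemma exists_abs_eval_le (l : SqrtPoly) (k : ℕ) (hl : l.length ≤ k + 1) :
    ∃ K : ℝ, ∀ x, 1 ≤ x → |eval l x| ≤ K * x ^ k := by
  induction l generalizing k with
  | nil => exact ⟨0, fun x _ => by simp⟩
  | cons c l ih =>
    rw [List.length_cons, add_le_add_iff_right] at hl
    rcases k with _ | k
    · rw [Nat.le_zero, List.length_eq_zero_iff] at hl
      exact ⟨|sqrtCast c|, fun x _ => by simp [hl]⟩
    · obtain ⟨K, hK⟩ := ih k hl
      refine ⟨|sqrtCast c| + K, fun x hx => ?_⟩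
      have hx0 : 0 ≤ x := zero_le_one.trans hx
      have h1 : 1 ≤ x ^ (k + 1) := one_le_pow₀ hx
      calc |eval (c :: l) x| ≤ |sqrtCast c| + |x * eval l x| := abs_add_le _ _
        _ = |sqrtCast c| * 1 + x * |eval l x| := by rw [abs_mul, abs_of_nonneg hx0, mul_one]
        _ ≤ |sqrtCast c| * x ^ (k + 1) + x * (K * x ^ k) := by
          gcongr
          exact hK x hx
        _ = _ := by ring

/-- If the degree of `N` is less than the degree of `D`, then `t N(m t²) / D(m t²)` tends to `0`
as `t → ∞`. -/
lemma tendsto_mul_eval_div (N D : SqrtPoly) (c : ℤ√29) (hND : N.length ≤ D.length)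
    (hD : ∀ e ∈ D ++ [c], PosCoeff e) {m : ℝ} (hm : 0 < m) :
    Tendsto (fun t : ℝ => t * (eval N (m * t ^ 2) / eval (D ++ [c]) (m * t ^ 2)))
      atTop (𝓝 0) := by
  have hc : 0 < sqrtCast c := (hD c (by simp)).sqrtCast_pos
  obtain ⟨K, hK⟩ : ∃ K : ℝ, ∀ x, 1 ≤ x → |x * eval N x| ≤ K * x ^ D.length := by
    obtain ⟨K, hK⟩ := exists_abs_eval_le (0 :: N) D.length (by simpa using hND)
    exact ⟨K, fun x hx => by simpa using hK x hx⟩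
  refine squeeze_zero_norm' (a := fun t => K / sqrtCast c / m / t) ?_
    (tendsto_const_nhds.div_atTop tendsto_id)
  have hx : Tendsto (fun t : ℝ => m * t ^ 2) atTop atTop :=
    (tendsto_pow_atTop two_ne_zero).const_mul_atTop hm
  filter_upwards [eventually_gt_atTop 0, hx.eventually_ge_atTop 1] with t ht hx1
  set x := m * t ^ 2 with hxdef
  have hx0 : 0 < x := by positivity
  have hlow : sqrtCast c * x ^ D.length ≤ eval (D ++ [c]) x := by
    rw [eval_append]
    have := eval_nonneg (fun e he => hD e (List.mem_append_left _ he)) hx0.le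
    simp
    linarith
  have hpow : 0 < x ^ D.length := by positivity
  have hden : 0 < eval (D ++ [c]) x := lt_of_lt_of_le (by positivity) hlow
  have h := hK x hx1
  rw [abs_mul, abs_of_pos hx0] at h
  have hK0 : 0 ≤ K := by
    by_contra hneg
    have : K * x ^ D.length < 0 := mul_neg_of_neg_of_pos (not_le.mp hneg) hpow
    have := mul_nonneg hx0.le (abs_nonneg (eval N x))
    linarith
  rw [norm_mul, norm_div, norm_eq_abs, norm_eq_abs, norm_eq_abs, abs_of_pos ht, abs_of_pos hden,
    div_div, div_div, mul_div_assoc', div_le_div_iff₀ hden (by positivity)]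
  calc t * |eval N x| * (sqrtCast c * (m * t)) = sqrtCast c * (x * |eval N x|) := by
        rw [hxdef]; ring
    _ ≤ sqrtCast c * (K * x ^ D.length) := by gcongr
    _ = K * (sqrtCast c * x ^ D.length) := by ring
    _ ≤ _ := by gcongr

end SqrtPoly

/-- Numerator of the isogeny of degree 29, up to a factor `29`. -/
def isogNum : SqrtPoly :=
  [⟨1399424, -259840⟩, ⟨53193398016, -9877765632⟩,
   ⟨252431014021056, -46875262512384⟩, ⟨205979279401199872, -38249391945861120⟩,
   ⟨31359515604707416992, -5823315855284652864⟩, ⟨910294195474541933376, -169037388469252370816⟩,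
   ⟨5065697688448466290928, -940676445359147794304⟩, ⟨5411301904497146118528, -1004853537133722289664⟩,
   ⟨1109785337605486552504, -206081963570584450064⟩, ⟨43672027858189330448, -8109691982004070560⟩,
   ⟨328871088720656084, -61069828036626000⟩, ⟨468752866265104, -87045222019072⟩,
   ⟨121234682990, -22512714732⟩, ⟨4854252, -901320⟩,
   ⟨29, 0⟩]

/-- Denominator of the isogeny of degree 29, up to a factor `29`. -/
def isogDen : SqrtPoly :=
  [⟨48256, 8960⟩, ⟨824064, 0⟩,
   ⟨5147124160, -955194112⟩, ⟨9947521780992, -1847206969856⟩,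
   ⟨3489526437672736, -647988789538240⟩, ⟨231693664705426496, -43024433418133760⟩,
   ⟨2943877860827356144, -546664394915793024⟩, ⟨7177159102339264384, -1332764986657755392⟩,
   ⟨3359387344858090392, -623822569070311856⟩, ⟨301837080344794192, -56049738708693632⟩,
   ⟨5199123908840052, -965453072391984⟩, ⟨17074750332496, -3170701520800⟩,
   ⟨10462700214, -1942872516⟩, ⟨1102812, -204624⟩,
   ⟨29, 0⟩]

open SqrtPoly in
/-- `P Q + 2 x (P' Q - P Q')` for the isogeny `t P(m t²) / Q(m t²)`. -/
def isogJac : SqrtPoly :=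
  add (mul isogNum isogDen) (0 :: smul 2
    (sub (mul (deriv isogNum) isogDen) (mul isogNum (deriv isogDen))))

lemma posCoeff_isogNum : ∀ c ∈ isogNum, PosCoeff c := by decide +kernel

lemma posCoeff_isogDen : ∀ c ∈ isogDen, PosCoeff c := by decide +kernel

lemma posCoeff_isogJac : ∀ c ∈ isogJac, PosCoeff c := by decide +kernel

lemma isogDen_eq_append : isogDen = isogDen.dropLast ++ [29] := by decide +kernel

lemma length_isogJac : isogJac.length = 29 := by decide +kernel

open SqrtPoly in
lemma isogNum_sub_isogDen :
    sub isogNum isogDen = (sub isogNum isogDen).dropLast ++ [0] := by decide +kernel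

open SqrtPoly in
lemma isogDen_deriv_sub :
    sub (0 :: deriv isogDen) (smul 14 isogDen) =
      (sub (0 :: deriv isogDen) (smul 14 isogDen)).dropLast ++ [0] := by decide +kernel

open SqrtPoly in
lemma isog_first_identity_coeff :
    ∀ c ∈ sub (add (add (0 :: 0 :: mul (mul isogNum isogNum) (mul isogNum isogNum))
        (0 :: smul (11484 * ⟨-70, 13⟩) (mul (mul isogNum isogNum) (mul isogDen isogDen))))
        (smul (1682 * ⟨-70, 13⟩ ^ 4) (mul (mul isogDen isogDen) (mul isogDen isogDen))))
      (mul [2, 396 * ⟨-70, 13⟩, 1] (mul isogJac isogJac)), c = 0 := by decide +kernel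

open SqrtPoly in
lemma isog_second_identity_coeff :
    ∀ c ∈ sub (0 :: mul isogNum isogNum)
      (sub (sub (mul [⟨334776, -62160⟩, 29] (mul isogDen isogDen))
        (mul (smul 2 [2, 792 * ⟨-70, 13⟩, 3]) (mul (deriv isogDen) isogDen)))
        (mul (smul 4 [0, 2, 396 * ⟨-70, 13⟩, 1]) (sub (mul (deriv (deriv isogDen)) isogDen)
          (mul (deriv isogDen) (deriv isogDen))))), c = 0 := by decide +kernel

lemma sqrt_twentyNine_sq : √(29 : ℝ) ^ 2 = 29 := sq_sqrt (by norm_num)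

lemma sqrtCast_unit : sqrtCast ⟨-70, 13⟩ = 13 * √29 - 70 := by
  rw [sqrtCast_apply]; push_cast; ring

lemma sqrtCast_unit_pos : 0 < 13 * √(29 : ℝ) - 70 := by
  have := abs_lt_of_sq_lt_sq (a := (70 : ℝ)) (b := 13 * √29)
    (by rw [mul_pow, sqrt_twentyNine_sq]; norm_num) (by positivity)
  linarith [(abs_lt.mp this).2]

/-- The argument `z` for which `gaussF (1 - z) = √29 * gaussF z`. -/
noncomputable def singularArg : ℝ := (1 - 1820 * √29 / 9801) / 2

lemma singularArg_pos : 0 < singularArg := by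
  have := abs_lt_of_sq_lt_sq (a := 1820 * √29) (b := (9801 : ℝ))
    (by rw [mul_pow, sqrt_twentyNine_sq]; norm_num) (by positivity)
  unfold singularArg
  linarith [(abs_lt.mp this).2]

lemma singularArg_lt : singularArg < 1 / 8 := by
  have := abs_lt_of_sq_lt_sq (a := (5 : ℝ)) (b := √29)
    (by rw [sqrt_twentyNine_sq]; norm_num) (by positivity)
  unfold singularArg
  linarith [(abs_lt.mp this).2]

lemma singularArg_lt_one : singularArg < 1 := singularArg_lt.trans (by norm_num)

lemma mul_one_sub_singularArg : singularArg * (1 - singularArg) = 1 / (4 * 9801 ^ 2) := by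
  unfold singularArg
  linear_combination -(1820 ^ 2 / (4 * 9801 ^ 2)) * sqrt_twentyNine_sq

/-- The scaling between the argument of the isogeny polynomials and the square of the coordinate on
the curve `y² = quartic singularArg t`. -/
noncomputable def isogScale : ℝ := 99 * (13 * √29 - 70)

lemma isogScale_pos : 0 < isogScale := mul_pos (by norm_num) sqrtCast_unit_pos

lemma isogScale_sq_mul : isogScale ^ 2 * (4 * (1 - singularArg)) = 2 := by
  unfold isogScale singularArg
  linear_combination (9801 * 2 * (169 - 1820 ^ 2 / 9801) + 2 * 1820 * 169 * √29) *
    sqrt_twentyNine_sq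

open SqrtPoly

lemma eval_isogJac (x : ℝ) : isogJac.eval x = isogNum.eval x * isogDen.eval x +
    2 * x * (isogNum.deriv.eval x * isogDen.eval x - isogNum.eval x * isogDen.deriv.eval x) := by
  simp [isogJac, map_ofNat]
  ring

lemma isog_first_identity (x : ℝ) :
    x ^ 2 * isogNum.eval x ^ 4 +
        11484 * (13 * √29 - 70) * x * isogNum.eval x ^ 2 * isogDen.eval x ^ 2 +
        1682 * (13 * √29 - 70) ^ 4 * isogDen.eval x ^ 4 =
      (x ^ 2 + 396 * (13 * √29 - 70) * x + 2) * isogJac.eval x ^ 2 := by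
  have h := eval_eq_zero isog_first_identity_coeff x
  simp only [eval_add, eval_sub, eval_mul, eval_smul, eval_cons, eval_nil, map_mul, map_pow,
    map_ofNat, map_zero, map_one, sqrtCast_unit] at h
  linear_combination h

lemma isog_second_identity (x : ℝ) :
    x * isogNum.eval x ^ 2 = (29 * x + (334776 - 62160 * √29)) * isogDen.eval x ^ 2 -
      2 * (3 * x ^ 2 + 792 * (13 * √29 - 70) * x + 2) * isogDen.deriv.eval x * isogDen.eval x -
      4 * (x ^ 3 + 396 * (13 * √29 - 70) * x ^ 2 + 2 * x) *
        (isogDen.deriv.deriv.eval x * isogDen.eval x - isogDen.deriv.eval x ^ 2) := by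
  have h := eval_eq_zero isog_second_identity_coeff x
  have hC : sqrtCast ⟨334776, -62160⟩ = 334776 - 62160 * √29 := by
    rw [sqrtCast_apply]; push_cast; ring
  simp only [eval_sub, eval_mul, eval_smul, eval_cons, eval_nil, map_mul,
    map_ofNat, map_zero, map_one, sqrtCast_unit, hC] at h
  linear_combination h

lemma eval_isogNum_pos {x : ℝ} (hx : 0 ≤ x) : 0 < isogNum.eval x :=
  eval_pos posCoeff_isogNum (by simp [isogNum]) hx

lemma eval_isogDen_pos {x : ℝ} (hx : 0 ≤ x) : 0 < isogDen.eval x :=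
  eval_pos posCoeff_isogDen (by simp [isogDen]) hx

lemma eval_isogJac_pos {x : ℝ} (hx : 0 ≤ x) : 0 < isogJac.eval x :=
  eval_pos posCoeff_isogJac (fun h => by simpa [h] using length_isogJac) hx

lemma isogScale_mul_sq_nonneg (t : ℝ) : 0 ≤ isogScale * t ^ 2 :=
  mul_nonneg isogScale_pos.le (sq_nonneg t)

lemma hasDerivAt_eval_scale (l : SqrtPoly) (t : ℝ) :
    HasDerivAt (fun t => l.eval (isogScale * t ^ 2))
      (l.deriv.eval (isogScale * t ^ 2) * (isogScale * (2 * t))) t := by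
  refine ((hasDerivAt_eval l _).comp t (((hasDerivAt_id' t).fun_pow 2).const_mul
    isogScale)).congr_deriv ?_
  simp

/-- The isogeny of degree 29 from `y² = quartic singularArg t` to
`y² = quartic (1 - singularArg) t`. -/
noncomputable def isogMap (t : ℝ) : ℝ :=
  t * isogNum.eval (isogScale * t ^ 2) / (√29 * isogDen.eval (isogScale * t ^ 2))

/-- The derivative of `isogMap`. -/
noncomputable def isogMapDeriv (t : ℝ) : ℝ :=
  isogJac.eval (isogScale * t ^ 2) / (√29 * isogDen.eval (isogScale * t ^ 2) ^ 2)

lemma isogMap_sq (t : ℝ) : 29 * isogMap t ^ 2 * isogDen.eval (isogScale * t ^ 2) ^ 2 =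
    t ^ 2 * isogNum.eval (isogScale * t ^ 2) ^ 2 := by
  have hQ := eval_isogDen_pos (isogScale_mul_sq_nonneg t)
  rw [isogMap, div_pow, mul_pow √29, sqrt_twentyNine_sq]
  generalize isogScale * t ^ 2 = x at *
  field_simp

lemma hasDerivAt_isogMap (t : ℝ) : HasDerivAt isogMap (isogMapDeriv t) t := by
  have hQ := eval_isogDen_pos (isogScale_mul_sq_nonneg t)
  have hr : 0 < √(29 : ℝ) := by positivity
  refine (((hasDerivAt_id' t).fun_mul (hasDerivAt_eval_scale isogNum t)).fun_div
    ((hasDerivAt_eval_scale isogDen t).const_mul √29) (by positivity)).congr_deriv ?_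
  rw [isogMapDeriv, eval_isogJac]
  field_simp
  ring

lemma quartic_isogMap (t : ℝ) :
    quartic (1 - singularArg) (isogMap t) * (29 * isogDen.eval (isogScale * t ^ 2) ^ 2) ^ 2 =
      quartic singularArg t * isogJac.eval (isogScale * t ^ 2) ^ 2 := by
  have hT := isogMap_sq t
  have h1 := isog_first_identity (isogScale * t ^ 2)
  have hm := isogScale_sq_mul
  have hm0 := isogScale_pos
  have hz : isogScale ^ 2 * (4 * singularArg) = 2 * (13 * √29 - 70) ^ 4 := by
    unfold isogScale singularArg
    linear_combination -(338 * (13 * √29 - 70) ^ 2) * sqrt_twentyNine_sq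
  have hs : isogScale = 99 * (13 * √29 - 70) := rfl
  generalize eval isogNum (isogScale * t ^ 2) = P at *
  generalize eval isogDen (isogScale * t ^ 2) = Q at *
  generalize eval isogJac (isogScale * t ^ 2) = B at *
  generalize isogMap t = T at *
  refine mul_left_cancel₀ (pow_ne_zero 2 hm0.ne') ?_
  unfold quartic
  have e : isogScale ^ 2 * (((T ^ 2 + 2) ^ 2 - 4 * (1 - singularArg)) * (29 * Q ^ 2) ^ 2) =
      isogScale ^ 2 * (t ^ 4 * P ^ 4 + 4 * t ^ 2 * P ^ 2 * (29 * Q ^ 2)) +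
        2 * (13 * √29 - 70) ^ 4 * (29 * Q ^ 2) ^ 2 := by
    linear_combination isogScale ^ 2 * (29 * T ^ 2 * Q ^ 2 + t ^ 2 * P ^ 2 + 4 * 29 * Q ^ 2) * hT +
      (29 * Q ^ 2) ^ 2 * hz
  rw [e]
  linear_combination h1 - B ^ 2 * hm + (116 * isogScale * t ^ 2 * P ^ 2 * Q ^ 2 -
    4 * isogScale * t ^ 2 * B ^ 2) * hs

lemma sqrt_quartic_isogMap (t : ℝ) :
    √(quartic (1 - singularArg) (isogMap t)) =
      √(quartic singularArg t) * isogMapDeriv t / √29 := by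
  have hQ := eval_isogDen_pos (isogScale_mul_sq_nonneg t)
  have hB := eval_isogJac_pos (isogScale_mul_sq_nonneg t)
  have hq := quartic_pos singularArg_pos.le singularArg_lt_one t
  have h := quartic_isogMap t
  have hr : √(29 : ℝ) * √29 = 29 := mul_self_sqrt (by norm_num)
  rw [sqrt_eq_iff_mul_self_eq_of_pos, isogMapDeriv]
  · rw [← eq_div_iff (by positivity)] at h
    rw [h]
    have hS := mul_self_sqrt hq.le
    generalize eval isogDen (isogScale * t ^ 2) = Q at *
    generalize eval isogJac (isogScale * t ^ 2) = B at *
    calc √(quartic singularArg t) * (B / (√29 * Q ^ 2)) / √29 *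
          (√(quartic singularArg t) * (B / (√29 * Q ^ 2)) / √29)
        = √(quartic singularArg t) * √(quartic singularArg t) * B ^ 2 /
          ((√29 * √29) * Q ^ 2) ^ 2 := by field_simp
      _ = _ := by rw [hS, hr]
  · have : 0 < isogMapDeriv t := by unfold isogMapDeriv; positivity
    have := sqrt_pos.mpr hq
    positivity

lemma isogMapDeriv_pos (t : ℝ) : 0 < isogMapDeriv t := by
  have hQ := eval_isogDen_pos (isogScale_mul_sq_nonneg t)
  have hB := eval_isogJac_pos (isogScale_mul_sq_nonneg t)
  unfold isogMapDeriv
  positivity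

lemma isogMapDeriv_div_sqrt (t : ℝ) :
    1 / √(quartic (1 - singularArg) (isogMap t)) * isogMapDeriv t =
      √29 * (1 / √(quartic singularArg t)) := by
  have h := isogMapDeriv_pos t
  have hq := sqrt_pos.mpr (quartic_pos singularArg_pos.le singularArg_lt_one t)
  rw [sqrt_quartic_isogMap]
  field_simp

lemma tendsto_isogMap_sub : Tendsto (fun t => isogMap t - t / √29) atTop (𝓝 0) := by
  have hD := posCoeff_isogDen
  rw [isogDen_eq_append] at hD
  have h := tendsto_mul_eval_div (sub isogNum isogDen).dropLast isogDen.dropLast 29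
    (by decide +kernel) hD isogScale_pos
  rw [← isogDen_eq_append] at h
  have h' := h.mul_const (1 / √29)
  rw [zero_mul] at h'
  refine h'.congr fun t => ?_
  have hQ := eval_isogDen_pos (isogScale_mul_sq_nonneg t)
  have e : eval (sub isogNum isogDen).dropLast (isogScale * t ^ 2) =
      eval isogNum (isogScale * t ^ 2) - eval isogDen (isogScale * t ^ 2) := by
    rw [← eval_sub]
    conv_rhs => rw [isogNum_sub_isogDen, eval_append]
    simp
  rw [e, isogMap]
  generalize isogScale * t ^ 2 = x at *
  field_simp

lemma tendsto_isogMap : Tendsto isogMap atTop atTop := by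
  have h : Tendsto (fun t => t / √29 + (isogMap t - t / √29)) atTop atTop :=
    (tendsto_id.atTop_div_const (by positivity)).atTop_add tendsto_isogMap_sub
  exact h.congr fun t => by ring

lemma isogMap_zero : isogMap 0 = 0 := by simp [isogMap]

lemma isogMap_pos {t : ℝ} (ht : 0 < t) : 0 < isogMap t := by
  have hQ := eval_isogDen_pos (isogScale_mul_sq_nonneg t)
  have hP := eval_isogNum_pos (isogScale_mul_sq_nonneg t)
  unfold isogMap
  positivity

lemma one_sub_singularArg_nonneg : 0 ≤ 1 - singularArg := by linarith [singularArg_lt_one]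

lemma one_sub_singularArg_lt_one : 1 - singularArg < 1 := by linarith [singularArg_pos]

lemma integral_comp_isogMap {g : ℝ → ℝ} (hg : Continuous g) (hgi : IntegrableOn g (Ioi 0))
    (hgT : IntegrableOn (fun t => g (isogMap t) * isogMapDeriv t) (Ioi 0)) :
    ∫ t in Ioi 0, g (isogMap t) * isogMapDeriv t = ∫ t in Ioi 0, g t := by
  have hsub : isogMap '' Ici 0 ⊆ Ici 0 := by
    rintro _ ⟨t, ht, rfl⟩
    rcases (mem_Ici.mp ht).eq_or_lt with h | h
    · simp [← h, isogMap_zero]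
    · exact (isogMap_pos h).le
  have h := integral_comp_mul_deriv_Ioi (a := 0)
    (fun t _ => (hasDerivAt_isogMap t).continuousAt.continuousWithinAt) tendsto_isogMap
    (fun t _ => (hasDerivAt_isogMap t).hasDerivWithinAt) hg.continuousOn
    (IntegrableOn.mono_set (Iff.mpr integrableOn_Ici_iff_integrableOn_Ioi hgi) hsub)
    (Iff.mpr integrableOn_Ici_iff_integrableOn_Ioi hgT)
  rwa [isogMap_zero] at h

lemma period_one_sub_singularArg : period (1 - singularArg) = √29 * period singularArg := by
  have hi := integrableOn_one_div_sqrt_quartic singularArg_pos.le singularArg_lt_one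
  rw [period, ← integral_comp_isogMap
    (continuous_one_div_sqrt_quartic one_sub_singularArg_nonneg one_sub_singularArg_lt_one)
    (integrableOn_one_div_sqrt_quartic one_sub_singularArg_nonneg one_sub_singularArg_lt_one)]
  · simp_rw [isogMapDeriv_div_sqrt]
    rw [integral_const_mul, period]
  · simp_rw [isogMapDeriv_div_sqrt]
    exact hi.const_mul _

lemma gaussF_one_sub_singularArg : gaussF (1 - singularArg) = √29 * gaussF singularArg := by
  have h := period_one_sub_singularArg
  rw [period_eq_gaussF one_sub_singularArg_nonneg one_sub_singularArg_lt_one,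
    period_eq_gaussF singularArg_pos.le singularArg_lt_one] at h
  have : π / (2 * √2) ≠ 0 := by positivity
  exact mul_left_cancel₀ this (by linarith)

lemma integrableOn_cube_isogMap :
    IntegrableOn (fun t => (1 / √(quartic (1 - singularArg) (isogMap t))) ^ 3 * isogMapDeriv t)
      (Ioi 0) := by
  have hi := integrableOn_one_div_sqrt_quartic singularArg_pos.le singularArg_lt_one
  have e : ∀ t, (1 / √(quartic (1 - singularArg) (isogMap t))) ^ 3 * isogMapDeriv t =
      (1 / √(quartic (1 - singularArg) (isogMap t))) ^ 2 *
        (√29 * (1 / √(quartic singularArg t))) := fun t => by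
    rw [← isogMapDeriv_div_sqrt]; ring
  simp_rw [e]
  have hc := (continuous_one_div_sqrt_quartic one_sub_singularArg_nonneg
    one_sub_singularArg_lt_one).comp
      (continuous_iff_continuousAt.mpr fun t => (hasDerivAt_isogMap t).continuousAt)
  refine Integrable.bdd_mul (c := 1 / (4 * singularArg)) (hi.const_mul √29)
    (hc.pow 2).aestronglyMeasurable (ae_of_all _ fun t => ?_)
  have hz := singularArg_pos
  have hq := le_quartic one_sub_singularArg_nonneg (isogMap t)
  have hq' : 4 * singularArg ≤ quartic (1 - singularArg) (isogMap t) := by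
    nlinarith [sq_nonneg (isogMap t), sq_nonneg (isogMap t ^ 2),
      mul_nonneg hz.le (sq_nonneg (isogMap t)), mul_nonneg hz.le (sq_nonneg (isogMap t ^ 2))]
  rw [norm_eq_abs, abs_of_nonneg (by positivity), div_pow, one_pow,
    sq_sqrt (by linarith)]
  gcongr

lemma periodCube_one_sub_singularArg :
    ∫ t in Ioi 0, (1 / √(quartic (1 - singularArg) (isogMap t))) ^ 3 * isogMapDeriv t =
      periodCube (1 - singularArg) :=
  integral_comp_isogMap (g := fun t => (1 / √(quartic (1 - singularArg) t)) ^ 3)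
    ((continuous_one_div_sqrt_quartic one_sub_singularArg_nonneg
      one_sub_singularArg_lt_one).pow 3)
    (periodCube_eq (by linarith [singularArg_lt_one]) one_sub_singularArg_lt_one).2
    integrableOn_cube_isogMap

/-- A function on the curve `y² = quartic z t` with differential
`16 z (1 - z) dt / y³ + (2 (1 - z) + t²) dt / y`. -/
noncomputable def quarticPrim (z t : ℝ) : ℝ := ((2 + 2 * z) * t + t ^ 3) / √(quartic z t)

lemma hasDerivAt_sqrt_quartic {z : ℝ} (h0 : 0 ≤ z) (h1 : z < 1) (t : ℝ) :
    HasDerivAt (fun t => √(quartic z t)) (2 * t * (t ^ 2 + 2) / √(quartic z t)) t := by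
  have hq := quartic_pos h0 h1 t
  have h : HasDerivAt (quartic z) (4 * t * (t ^ 2 + 2)) t := by
    refine ((((hasDerivAt_id' t).fun_pow 2).add_const 2).fun_pow 2 |>.sub_const
      (4 * z)).congr_deriv ?_
    simp
    ring
  refine (h.sqrt hq.ne').congr_deriv ?_
  field_simp
  ring

lemma hasDerivAt_quarticPrim {z : ℝ} (h0 : 0 ≤ z) (h1 : z < 1) (t : ℝ) :
    HasDerivAt (quarticPrim z) (16 * z * (1 - z) * (1 / √(quartic z t)) ^ 3 +
      (2 * (1 - z) + t ^ 2) * (1 / √(quartic z t))) t := by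
  have hq := quartic_pos h0 h1 t
  have hS := sqrt_pos.mpr hq
  have hSS := sq_sqrt hq.le
  refine ((((hasDerivAt_id' t).const_mul (2 + 2 * z)).fun_add
    ((hasDerivAt_id' t).fun_pow 3)).fun_div (hasDerivAt_sqrt_quartic h0 h1 t) hS.ne').congr_deriv ?_
  generalize √(quartic z t) = S at *
  rw [quartic] at hSS
  field_simp
  push_cast
  linear_combination (2 + 2 * z + 3 * t ^ 2 - (2 * (1 - z) + t ^ 2)) * hSS

lemma quarticPrim_zero (z : ℝ) : quarticPrim z 0 = 0 := by simp [quarticPrim]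

lemma sqrt_quartic_le {z : ℝ} (h0 : 0 ≤ z) (t : ℝ) : √(quartic z t) ≤ t ^ 2 + 2 := by
  refine sqrt_le_iff.mpr ⟨by positivity, ?_⟩
  unfold quartic; linarith

lemma tendsto_quarticPrim_sub {z : ℝ} (h0 : 0 ≤ z) (h1 : z < 1) :
    Tendsto (fun t => quarticPrim z t - t) atTop (𝓝 0) := by
  refine squeeze_zero_norm' (a := fun t => 4 * z * (1 / √(1 - z)) / t) ?_
    (tendsto_const_nhds.div_atTop tendsto_id)
  filter_upwards [eventually_gt_atTop 0] with t ht
  have hq := quartic_pos h0 h1 t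
  have hS := sqrt_pos.mpr hq
  have hSS := sq_sqrt hq.le
  have hle := sqrt_quartic_le h0 t
  have hd := one_div_sqrt_quartic_le h0 h1 t
  have hz : 0 < √(1 - z) := sqrt_pos.mpr (by linarith)
  have e : quarticPrim z t - t =
      t * (2 * z + (t ^ 2 + 2 - √(quartic z t))) * (1 / √(quartic z t)) := by
    rw [quarticPrim]; field_simp; ring
  generalize √(quartic z t) = S at *
  have hw : t ^ 2 + 2 - S ≤ 2 * z := by
    have : (t ^ 2 + 2 - S) * (t ^ 2 + 2 + S) = 4 * z := by
      rw [quartic] at hSS; linear_combination -hSS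
    nlinarith [sq_nonneg t]
  rw [e, norm_eq_abs, abs_of_nonneg
    (mul_nonneg (mul_nonneg ht.le (by linarith)) (by positivity))]
  calc t * (2 * z + (t ^ 2 + 2 - S)) * (1 / S)
      ≤ t * (2 * z + 2 * z) * (1 / √(1 - z) * (1 / (t ^ 2 + 2))) := by gcongr
    _ = 4 * z * (1 / √(1 - z)) * (t / (t ^ 2 + 2)) := by ring
    _ ≤ 4 * z * (1 / √(1 - z)) * (1 / t) := by
      gcongr ?_ * ?_
      rw [div_le_div_iff₀ (by positivity) ht]
      linarith
    _ = _ := by ring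

/-- The function `y Q'(m t²) / Q(m t²)` with poles at the kernel of the isogeny. -/
noncomputable def isogPrim (t : ℝ) : ℝ :=
  t * √(quartic singularArg t) *
    (isogDen.deriv.eval (isogScale * t ^ 2) / isogDen.eval (isogScale * t ^ 2))

lemma hasDerivAt_isogPrim (t : ℝ) :
    HasDerivAt isogPrim ((29 * t ^ 2 + 296 * √29 / 33 - 29 * isogMap t ^ 2) /
      (2 * isogScale * √(quartic singularArg t))) t := by
  have hm := isogScale_pos
  have hms := isogScale_sq_mul
  have hQ := eval_isogDen_pos (isogScale_mul_sq_nonneg t)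
  have hq := quartic_pos singularArg_pos.le singularArg_lt_one t
  have hS := sqrt_pos.mpr hq
  have hSS := sq_sqrt hq.le
  have hT := isogMap_sq t
  have h2 := isog_second_identity (isogScale * t ^ 2)
  have hs : isogScale = 99 * (13 * √29 - 70) := rfl
  have hC : isogScale * (296 * √29 / 33) = 334776 - 62160 * √29 := by
    rw [hs]; linear_combination (296 * 39) * sqrt_twentyNine_sq
  refine (((hasDerivAt_id' t).fun_mul
    (hasDerivAt_sqrt_quartic singularArg_pos.le singularArg_lt_one t)).fun_mul
    ((hasDerivAt_eval_scale isogDen.deriv t).fun_div (hasDerivAt_eval_scale isogDen t)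
      hQ.ne')).congr_deriv ?_
  rw [← hC] at h2
  have hu : 13 * √29 - 70 = isogScale / 99 := by rw [hs]; ring
  rw [hu] at h2
  generalize eval isogDen.deriv.deriv (isogScale * t ^ 2) = R at *
  generalize eval isogDen.deriv (isogScale * t ^ 2) = D at *
  generalize eval isogDen (isogScale * t ^ 2) = Q at *
  generalize eval isogNum (isogScale * t ^ 2) = P at *
  generalize √(quartic singularArg t) = S at *
  generalize isogMap t = T at *
  generalize 296 * √29 / 33 = c at *
  clear hs hC hu hq
  generalize isogScale = m at *
  have key : (29 * t ^ 2 + c) * Q ^ 2 - t ^ 2 * P ^ 2 =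
      2 * m * ((S ^ 2 + 2 * t ^ 2 * (t ^ 2 + 2)) * D * Q +
        2 * m * t ^ 2 * S ^ 2 * (R * Q - D ^ 2)) := by
    refine mul_left_cancel₀ hm.ne' ?_
    rw [hSS, quartic]
    linear_combination -h2 + (2 * D * Q + 4 * m * t ^ 2 * (R * Q - D ^ 2)) * (-hms)
  rw [eq_div_iff (by positivity)]
  field_simp
  linear_combination -key + hT

lemma tendsto_isogPrim_sub :
    Tendsto (fun t => isogScale * isogPrim t - 14 * t) atTop (𝓝 0) := by
  have hD := posCoeff_isogDen
  rw [isogDen_eq_append] at hD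
  have h := tendsto_mul_eval_div (sub (0 :: deriv isogDen) (smul 14 isogDen)).dropLast
    isogDen.dropLast 29 (by decide +kernel) hD isogScale_pos
  rw [← isogDen_eq_append] at h
  have h' := (h.abs.const_mul 3).add
    ((tendsto_const_nhds (x := (28 : ℝ))).div_atTop (tendsto_id (α := ℝ) (x := atTop)))
  rw [abs_zero, mul_zero, zero_add] at h'
  refine squeeze_zero_norm' ?_ h'
  filter_upwards [eventually_ge_atTop 1] with t ht
  have ht0 : 0 < t := by linarith
  have hq := quartic_pos singularArg_pos.le singularArg_lt_one t
  have hS := sqrt_pos.mpr hq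
  have hle := sqrt_quartic_le singularArg_pos.le t
  have hge : t ^ 2 ≤ √(quartic singularArg t) := by
    refine le_sqrt_of_sq_le ?_
    unfold quartic
    nlinarith [sq_nonneg t, singularArg_lt_one]
  have hQ := eval_isogDen_pos (isogScale_mul_sq_nonneg t)
  have e : eval (sub (0 :: deriv isogDen) (smul 14 isogDen)).dropLast (isogScale * t ^ 2) =
      isogScale * t ^ 2 * eval isogDen.deriv (isogScale * t ^ 2) -
        14 * eval isogDen (isogScale * t ^ 2) := by
    have : eval (sub (0 :: deriv isogDen) (smul 14 isogDen)) (isogScale * t ^ 2) =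
        isogScale * t ^ 2 * eval isogDen.deriv (isogScale * t ^ 2) -
          14 * eval isogDen (isogScale * t ^ 2) := by
      simp [map_ofNat]
    rw [← this]
    conv_rhs => rw [isogDen_deriv_sub, eval_append]
    simp
  have e' : isogScale * isogPrim t - 14 * t = √(quartic singularArg t) / t ^ 2 *
      (t * ((isogScale * t ^ 2 * eval isogDen.deriv (isogScale * t ^ 2) -
        14 * eval isogDen (isogScale * t ^ 2)) / eval isogDen (isogScale * t ^ 2))) +
      14 * (√(quartic singularArg t) - t ^ 2) / t := by
    rw [isogPrim]
    generalize eval isogDen (isogScale * t ^ 2) = Q at *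
    field_simp
    ring
  rw [e, e']
  refine (norm_add_le _ _).trans (add_le_add ?_ ?_)
  · rw [norm_mul, norm_eq_abs, norm_eq_abs, abs_of_pos (by positivity)]
    refine mul_le_mul_of_nonneg_right ?_ (abs_nonneg _)
    rw [div_le_iff₀ (by positivity)]
    nlinarith
  · rw [norm_eq_abs, abs_of_nonneg (div_nonneg (by linarith) ht0.le), id]
    gcongr
    linarith

/-- The function on the curve relating the differentials of the second kind on both sides of the
isogeny. -/
noncomputable def secondKindPrim (t : ℝ) : ℝ :=
  quarticPrim (1 - singularArg) (isogMap t) + 2 * isogScale / √29 * isogPrim t -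
    √29 * quarticPrim singularArg t

lemma secondKindPrim_zero : secondKindPrim 0 = 0 := by
  simp [secondKindPrim, isogMap_zero, quarticPrim_zero, isogPrim]

lemma tendsto_secondKindPrim : Tendsto secondKindPrim atTop (𝓝 0) := by
  have h1 := (tendsto_quarticPrim_sub one_sub_singularArg_nonneg
    one_sub_singularArg_lt_one).comp tendsto_isogMap
  have h2 := (tendsto_quarticPrim_sub singularArg_pos.le singularArg_lt_one).const_mul √29
  have h := ((h1.add tendsto_isogMap_sub).add (tendsto_isogPrim_sub.const_mul (2 / √29))).sub h2
  simp only [mul_zero, add_zero, sub_zero] at h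
  refine h.congr fun t => ?_
  have hr : 0 < √(29 : ℝ) := by positivity
  have hrr := sqrt_twentyNine_sq
  simp only [Function.comp_apply, secondKindPrim]
  field_simp
  linear_combination t * hrr

lemma hasDerivAt_secondKindPrim (t : ℝ) :
    HasDerivAt secondKindPrim (16 * singularArg * (1 - singularArg) *
        ((1 / √(quartic (1 - singularArg) (isogMap t))) ^ 3 * isogMapDeriv t -
          √29 * (1 / √(quartic singularArg t)) ^ 3) -
      17648 / 9801 * (1 / √(quartic singularArg t))) t := by
  have hm := isogScale_pos
  have hS := sqrt_pos.mpr (quartic_pos singularArg_pos.le singularArg_lt_one t)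
  have h1 := isogMapDeriv_div_sqrt t
  have hr : 0 < √(29 : ℝ) := by positivity
  have hrr := sqrt_twentyNine_sq
  have hz : 4 * singularArg - 2 = -(3640 * √29 / 9801) := by unfold singularArg; ring
  refine ((((hasDerivAt_quarticPrim one_sub_singularArg_nonneg one_sub_singularArg_lt_one
    (isogMap t)).comp t (hasDerivAt_isogMap t)).fun_add ((hasDerivAt_isogPrim t).const_mul
      (2 * isogScale / √29))).fun_sub ((hasDerivAt_quarticPrim singularArg_pos.le
        singularArg_lt_one t).const_mul √29)).congr_deriv ?_
  generalize √(quartic singularArg t) = S at *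
  generalize √(quartic (1 - singularArg) (isogMap t)) = U at *
  generalize isogMapDeriv t = T' at *
  generalize isogMap t = T at *
  have e : 2 * isogScale / √29 * ((29 * t ^ 2 + 296 * √29 / 33 - 29 * T ^ 2) /
      (2 * isogScale * S)) = (√29 * t ^ 2 + 296 / 33 - √29 * T ^ 2) * (1 / S) := by
    field_simp
    linear_combination (33 * T ^ 2 - 33 * t ^ 2) * hrr
  rw [e]
  linear_combination (2 * singularArg + T ^ 2) * h1 + √29 * (1 / S) * hz -
    3640 / 9801 * (1 / S) * hrr

lemma deriv_gaussF_one_sub_singularArg :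
    deriv gaussF (1 - singularArg) =
      √29 * deriv gaussF singularArg + 8824 * 9801 * gaussF singularArg := by
  obtain ⟨c1, i1⟩ := periodCube_eq singularArg_pos singularArg_lt_one
  obtain ⟨c2, -⟩ := periodCube_eq (by linarith [singularArg_lt_one]) one_sub_singularArg_lt_one
  have hp := period_eq_gaussF singularArg_pos.le singularArg_lt_one
  have i2 := integrableOn_cube_isogMap
  have i0 := integrableOn_one_div_sqrt_quartic singularArg_pos.le singularArg_lt_one
  have hA : Integrable (fun t => 16 * singularArg * (1 - singularArg) *
        ((1 / √(quartic (1 - singularArg) (isogMap t))) ^ 3 * isogMapDeriv t -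
          √29 * (1 / √(quartic singularArg t)) ^ 3)) (volume.restrict (Ioi 0)) :=
    (i2.sub (i1.const_mul √29)).const_mul _
  have hB : Integrable (fun t => 17648 / 9801 * (1 / √(quartic singularArg t)))
      (volume.restrict (Ioi 0)) := i0.const_mul _
  have h := integral_Ioi_of_hasDerivAt_of_tendsto' (a := 0)
    (fun t _ => hasDerivAt_secondKindPrim t) (hA.sub hB) tendsto_secondKindPrim
  rw [integral_sub hA hB, integral_const_mul, integral_const_mul,
    integral_sub i2 (i1.const_mul √29), integral_const_mul, periodCube_one_sub_singularArg,
    secondKindPrim_zero, ← period, ← periodCube, hp] at h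
  have hK : 0 < π / (2 * √2) := by positivity
  refine mul_left_cancel₀ hK.ne' ?_
  linear_combination -c2 + √29 * c1 + 9801 ^ 2 / 2 * h - 8 * 9801 ^ 2 *
    (periodCube (1 - singularArg) - √29 * periodCube singularArg) * mul_one_sub_singularArg

lemma abs_singularArg_lt : |singularArg| < 1 / 8 := by
  rw [abs_of_pos singularArg_pos]; exact singularArg_lt

/-- Ramanujan's series as a combination of `∑ sₙ xⁿ` and `∑ n sₙ xⁿ`. -/
lemma powerSum_clausenCoeff_combination :
    1103 * powerSum clausenCoeff (1 / 99 ^ 4) +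
      26390 * powerSum (fun n => (n : ℝ) * clausenCoeff n) (1 / 99 ^ 4) = 9801 / (√8 * π) := by
  have hz := abs_singularArg_lt
  have hw := mul_one_sub_singularArg
  have hx : 4 * singularArg * (1 - singularArg) = 1 / 99 ^ 4 := by
    rw [mul_assoc, hw]; norm_num
  have hL := gaussF_legendre singularArg_pos singularArg_lt_one
  obtain ⟨d1, d2⟩ := logisticDeriv_powerSum_comp polyBounded_clausenCoeff hz
  have hF := (differentiableAt_gaussF (hz.trans (by norm_num))).hasDerivAt.fun_pow 2
  have heq : (fun z => gaussF z ^ 2) =ᶠ[𝓝 singularArg]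
      fun z => powerSum clausenCoeff (4 * z * (1 - z)) := by
    filter_upwards [eventually_abs_lt hz] with z hz using gaussF_sq hz
  have hd := (hF.congr_of_eventuallyEq heq.symm).unique d1
  rw [← hd, hx] at d2
  have hS := gaussF_sq hz
  rw [hx] at hS
  rw [logisticDeriv, logisticDeriv, gaussF_one_sub_singularArg,
    deriv_gaussF_one_sub_singularArg] at hL
  have h8 : √(8 : ℝ) = 2 * √2 := by
    rw [show (8 : ℝ) = 2 ^ 2 * 2 by norm_num, sqrt_mul (by norm_num), sqrt_sq (by norm_num)]
  have hrr := sqrt_twentyNine_sq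
  have hz' : 1 - 2 * singularArg = 1820 * √29 / 9801 := by unfold singularArg; ring
  rw [hz'] at d2
  have e : 9801 / (√8 * π) = 9801 / 2 * (1 / (√2 * π)) := by rw [h8]; field_simp
  rw [e, ← hL, ← hS]
  generalize powerSum (fun n => (n : ℝ) * clausenCoeff n) (1 / 99 ^ 4) = D at *
  push_cast at d2
  linear_combination -(9801 / 2 * √29) * d2 - 910 * D * hrr -
    9801 ^ 2 * 4412 * gaussF singularArg ^ 2 * hw

theorem ramanujan_one_over_pi_series :
    HasSum
      (fun n : ℕ =>
        ((4 * n).factorial : ℝ) * (1103 + 26390 * n) /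
          ((n.factorial : ℝ) ^ 4 * 396 ^ (4 * n)))
      (9801 / (Real.sqrt 8 * π)) := by
  have hx : |(1 / 99 ^ 4 : ℝ)| < 1 := by norm_num [abs_of_pos]
  rw [← powerSum_clausenCoeff_combination]
  refine (((polyBounded_clausenCoeff.hasSum hx).mul_left 1103).add
    ((polyBounded_clausenCoeff.nat_mul.hasSum hx).mul_left 26390)).congr_fun fun n => ?_
  have h : (396 : ℝ) ^ (4 * n) = 256 ^ n * (99 ^ 4) ^ n := by
    rw [pow_mul, ← mul_pow]; norm_num
  rw [h, clausenCoeff, one_div, inv_pow]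
  field_simp
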